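/- arXiv:1901.11432 — 2 statements merged into one kernel-verified Lean document; each statement's English description precedes it below -/
import Mathlib

section
/- Let T > 0, s > 5/2, let f : ℝ → ℝ be infinitely differentiable with f(0) = 0, and let u₁, u₂ : 𝕊¹ × [0,T] → ℝ be solutions of the generalized Benjamin–Ono equation ∂ₜu - ℋ∂ₓ²u + ∂ₓ(f(u)) = 0 on 𝕊¹ × [0,T], in the following sense: each uᵢ is continuous on 𝕊¹ × [0,T], differentiable in t on 𝕊¹ × (0,T) with ∂ₜuᵢ continuous there; for every t ∈ [0,T] the function uᵢ(·,t) belongs to H^s(𝕊¹), is twice continuously differentiable in x; and for every (x,t) ∈ 𝕊¹ × (0,T), ∂ₜuᵢ(x,t) - vᵢ(x,t) + f′(uᵢ(x,t))·∂ₓuᵢ(x,t) = 0, where vᵢ(·,t) is the continuous representative of ℋ(∂ₓ²uᵢ(·,t)). If there exists a nonempty open set Ω ⊆ 𝕊¹ × (0,T) such that u₁(x,t) = u₂(x,t) for all (x,t) ∈ Ω, then u₁(x,t) = u₂(x,t) for all (x,t) ∈ 𝕊¹ × [0,T]. In particular, if u₁ vanishes on Ω then u₁ ≡ 0. -/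
open MeasureTheory Complex Filter Topology

noncomputable section

/-- The `n`-th Fourier coefficient of a `1`-periodic function `f : ℝ → ℂ` (viewed as a
function on `𝕊¹ = ℝ/ℤ`) : `f̂(n) = ∫₀¹ f(x) e^{-2πinx} dx`. -/
def fourierCoefP (f : ℝ → ℂ) (n : ℤ) : ℂ :=
  ∫ x in (0 : ℝ)..1, Complex.exp (-2 * Real.pi * Complex.I * n * x) * f x

/-- `f ∈ H^s(𝕊¹)` for a `1`-periodic `f : ℝ → ℂ` : `∑ₙ (1+n²)^s |f̂(n)|² < ∞`. -/
def MemHsP (s : ℝ) (f : ℝ → ℂ) : Prop :=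
  Summable fun n : ℤ => (1 + (n : ℝ) ^ 2) ^ s * ‖fourierCoefP f n‖ ^ 2

/-- `HasPeriodicHilbertTransform f h` : the `1`-periodic function `h` has Fourier
coefficients `ĥ(n) = -i · sgn(n) · f̂(n)`, i.e. `h` represents the periodic Hilbert
transform `ℋf` of the `1`-periodic function `f`. -/
def HasPeriodicHilbertTransform (f h : ℝ → ℂ) : Prop :=
  ∀ n : ℤ, fourierCoefP h n = -Complex.I * (Int.sign n : ℂ) * fourierCoefP f n

/-- `IsPeriodicGBOSolution T s f u ux uxx ut v` : `u : 𝕊¹ × [0,T] → ℝ` (realized as a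
`1`-periodic function of `x ∈ ℝ`) is a solution of the generalized Benjamin–Ono equation
`∂ₜu - ℋ∂ₓ²u + ∂ₓ(f(u)) = 0`, i.e. `∂ₜu - ℋ∂ₓ²u + f′(u)·∂ₓu = 0`, in the class
`C([0,T] : H^s(𝕊¹)) ∩ C¹((0,T) : ⋯)`, where `ux, uxx` are the first and second spatial
derivatives, `ut` is the time derivative, and `v(·,t)` is the continuous representative of
the periodic Hilbert transform `ℋ(∂ₓ²u(·,t))`. -/
structure IsPeriodicGBOSolution (T s : ℝ) (f : ℝ → ℝ) (u ux uxx ut v : ℝ → ℝ → ℝ) : Prop where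
  periodic : ∀ t ∈ Set.Icc 0 T, Function.Periodic (fun x => u x t) 1
  cont : ContinuousOn (fun p : ℝ × ℝ => u p.1 p.2) (Set.univ ×ˢ Set.Icc 0 T)
  deriv_t : ∀ x : ℝ, ∀ t ∈ Set.Ioo 0 T, HasDerivAt (fun τ => u x τ) (ut x t) t
  cont_ut : ContinuousOn (fun p : ℝ × ℝ => ut p.1 p.2) (Set.univ ×ˢ Set.Ioo 0 T)
  sobolev : ∀ t ∈ Set.Icc 0 T, MemHsP s fun x => (u x t : ℂ)
  deriv_x : ∀ t ∈ Set.Icc 0 T, ∀ x : ℝ, HasDerivAt (fun y => u y t) (ux x t) x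
  deriv_xx : ∀ t ∈ Set.Icc 0 T, ∀ x : ℝ, HasDerivAt (fun y => ux y t) (uxx x t) x
  cont_uxx : ∀ t ∈ Set.Icc 0 T, Continuous fun x => uxx x t
  periodic_v : ∀ t ∈ Set.Ioo 0 T, Function.Periodic (fun x => v x t) 1
  cont_v : ∀ t ∈ Set.Ioo 0 T, Continuous fun x => v x t
  hilbert : ∀ t ∈ Set.Ioo 0 T,
    HasPeriodicHilbertTransform (fun x => (uxx x t : ℂ)) fun x => (v x t : ℂ)
  equation : ∀ x : ℝ, ∀ t ∈ Set.Ioo 0 T,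
    ut x t - v x t + deriv f (u x t) * ux x t = 0


open scoped ComplexConjugate

lemma coefP_bridge (φ : ℝ → ℂ) (hp : Function.Periodic φ 1) (n : ℤ) :
    fourierCoeff (T := (1:ℝ)) hp.lift n = fourierCoefP φ n := by
  rw [fourierCoeff_eq_intervalIntegral _ _ 0, fourierCoefP]
  simp only [zero_add, one_div, inv_one, one_smul, Function.Periodic.lift_coe, smul_eq_mul]
  apply intervalIntegral.integral_congr
  intro x _
  simp only [fourier_coe_apply]
  congr 2
  push_cast
  ring

lemma lift_cont (φ : ℝ → ℂ) (hp : Function.Periodic φ 1) (hc : Continuous φ) :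
    Continuous (hp.lift : AddCircle (1:ℝ) → ℂ) :=
  continuous_coinduced_dom.mpr hc

lemma parsevalP (φ ψ : ℝ → ℂ) (hp : Function.Periodic φ 1) (hc : Continuous φ)
    (hp' : Function.Periodic ψ 1) (hc' : Continuous ψ) :
    HasSum (fun n => conj (fourierCoefP φ n) * fourierCoefP ψ n)
      (∫ x in (0:ℝ)..1, conj (φ x) * ψ x) := by
  let Φ : C(AddCircle (1:ℝ), ℂ) := ⟨hp.lift, lift_cont φ hp hc⟩
  let Ψ : C(AddCircle (1:ℝ), ℂ) := ⟨hp'.lift, lift_cont ψ hp' hc'⟩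
  have key := (fourierBasis (T := (1:ℝ))).hasSum_inner_mul_inner
    (ContinuousMap.toLp (E := ℂ) 2 AddCircle.haarAddCircle ℂ Φ)
    (ContinuousMap.toLp (E := ℂ) 2 AddCircle.haarAddCircle ℂ Ψ)
  rw [MeasureTheory.ContinuousMap.inner_toLp] at key
  have e1 : (fun n => conj (fourierCoefP φ n) * fourierCoefP ψ n) = fun i =>
      inner ℂ ((ContinuousMap.toLp 2 AddCircle.haarAddCircle ℂ) Φ) (fourierBasis i) *
        inner ℂ (fourierBasis i) ((ContinuousMap.toLp 2 AddCircle.haarAddCircle ℂ) Ψ) := by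
    ext n
    rw [← HilbertBasis.repr_apply_apply, fourierBasis_repr, fourierCoeff_toLp,
      ← inner_conj_symm, ← HilbertBasis.repr_apply_apply, fourierBasis_repr, fourierCoeff_toLp]
    rw [← coefP_bridge φ hp, ← coefP_bridge ψ hp']
    rfl
  have e2 : (∫ x in (0:ℝ)..1, conj (φ x) * ψ x) =
      ∫ (x : AddCircle (1:ℝ)), Ψ x * (starRingEnd ℂ) (Φ x) ∂AddCircle.haarAddCircle := by
    rw [AddCircle.integral_haarAddCircle, ← AddCircle.intervalIntegral_preimage 1 0]
    simp only [zero_add, inv_one, one_smul]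
    apply intervalIntegral.integral_congr
    intro x _
    simp only [Φ, Ψ, ContinuousMap.coe_mk, Function.Periodic.lift_coe]
    ring
  rw [e1, e2]
  exact key

lemma parsevalP_self (φ : ℝ → ℂ) (hp : Function.Periodic φ 1) (hc : Continuous φ) :
    HasSum (fun n => ‖fourierCoefP φ n‖ ^ 2) (∫ x in (0:ℝ)..1, ‖φ x‖ ^ 2) := by
  have := parsevalP φ φ hp hc hp hc
  simp only [Complex.conj_mul'] at this
  have h2 := Complex.hasSum_re this
  convert h2 using 1
  · ext n; norm_cast
  · rw [show (fun x => (‖φ x‖ : ℂ) ^ 2) = fun x => ((‖φ x‖ ^ 2 : ℝ) : ℂ) by ext; push_cast; rfl,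
      intervalIntegral.integral_ofReal, Complex.ofReal_re]

/-- nonneg continuous function with zero integral vanishes, periodic version -/
lemma zero_of_integral_zero (g : ℝ → ℝ) (hp : Function.Periodic g 1) (hc : Continuous g)
    (h0 : ∀ x, 0 ≤ g x) (hI : ∫ x in (0:ℝ)..1, g x = 0) : ∀ x, g x = 0 := by
  have h1 : ∀ x ∈ Set.Icc (0:ℝ) 1, g x = 0 := by
    by_contra! hne
    obtain ⟨x, hx, hgx⟩ := hne
    have := intervalIntegral.integral_pos (a := 0) (b := 1) (f := g) one_pos hc.continuousOn
      (fun x _ => h0 x) ⟨x, hx, lt_of_le_of_ne (h0 x) (Ne.symm hgx)⟩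
    linarith
  intro x
  have := hp.int_mul ⌊x⌋ (Int.fract x)
  rw [mul_one, Int.fract_add_floor] at this
  rw [this]
  exact h1 _ ⟨Int.fract_nonneg x, (Int.fract_lt_one x).le⟩

lemma zero_of_coef (φ : ℝ → ℂ) (hp : Function.Periodic φ 1) (hc : Continuous φ)
    (h : ∀ n, fourierCoefP φ n = 0) : ∀ x, φ x = 0 := by
  have h1 := parsevalP_self φ hp hc
  simp only [h, norm_zero, ne_eq, OfNat.ofNat_ne_zero, not_false_eq_true, zero_pow] at h1
  have h2 := h1.unique hasSum_zero
  intro x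
  have := zero_of_integral_zero (fun x => ‖φ x‖ ^ 2) (fun x => by simp only [hp x])
    (by fun_prop) (fun x => by positivity) h2 x
  simpa using this

lemma exp_int_periodic (m : ℤ) (x : ℝ) :
    Complex.exp (2 * Real.pi * Complex.I * m * ((x + 1 : ℝ) : ℂ)) =
      Complex.exp (2 * Real.pi * Complex.I * m * x) := by
  rw [show (2 * Real.pi * Complex.I * m * ((x + 1 : ℝ) : ℂ)) =
    2 * Real.pi * Complex.I * m * x + m * (2 * Real.pi * Complex.I) by push_cast; ring,
    Complex.exp_add, Complex.exp_int_mul_two_pi_mul_I, mul_one]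

lemma coef_mul (φ ψ : ℝ → ℂ) (hp : Function.Periodic φ 1) (hc : Continuous φ)
    (hp' : Function.Periodic ψ 1) (hc' : Continuous ψ) (n : ℤ) :
    HasSum (fun k => fourierCoefP φ (n - k) * fourierCoefP ψ k)
      (fourierCoefP (fun x => φ x * ψ x) n) := by
  have := parsevalP (fun x => Complex.exp (2 * Real.pi * Complex.I * n * x) * conj (φ x)) ψ
    (fun x => by simp only [hp x, exp_int_periodic])
    (by
      have : Continuous fun x => conj (φ x) := Complex.continuous_conj.comp hc
      fun_prop) hp' hc'
  have hconj : ∀ (m : ℤ) (x : ℝ), conj (Complex.exp (2 * Real.pi * Complex.I * m * x)) =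
      Complex.exp (-2 * Real.pi * Complex.I * m * x) := by
    intro m x
    rw [← Complex.exp_conj]
    simp [Complex.conj_ofNat]
  convert this using 1
  · ext k
    congr 1
    unfold fourierCoefP
    rw [intervalIntegral, intervalIntegral]
    simp only [zero_le_one, Set.Ioc_eq_empty_of_le, Measure.restrict_empty, integral_zero_measure,
      sub_zero]
    rw [← integral_conj]
    congr 1
    ext x
    simp only [map_mul, Complex.conj_conj, hconj]
    rw [← mul_assoc, ← Complex.exp_conj, ← Complex.exp_add]
    congr 2
    simp [Complex.conj_ofNat]
    ring
  · unfold fourierCoefP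
    congr 1
    ext x
    simp only [map_mul, Complex.conj_conj, hconj]
    ring

lemma coef_shift (φ : ℝ → ℂ) (hp : Function.Periodic φ 1) (c : ℝ) (n : ℤ) :
    fourierCoefP (fun x => φ (x + c)) n =
      Complex.exp (2 * Real.pi * Complex.I * n * c) * fourierCoefP φ n := by
  unfold fourierCoefP
  have hper : Function.Periodic (fun x : ℝ => Complex.exp (-2 * Real.pi * Complex.I * n * x) * φ x) 1 := by
    intro x
    have := exp_int_periodic (-n) x
    push_cast at this
    simp only [hp x]
    congr 1
    convert this using 2 <;> push_cast <;> ring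
  have h1 := hper.intervalIntegral_add_eq c 0
  rw [zero_add] at h1
  rw [← h1, ← intervalIntegral.integral_const_mul]
  have h2 := intervalIntegral.integral_comp_add_right (a := 0) (b := 1)
    (fun x : ℝ => Complex.exp (2 * Real.pi * Complex.I * n * c) *
      (Complex.exp (-2 * Real.pi * Complex.I * n * x) * φ x)) c
  rw [zero_add, add_comm 1 c] at h2
  rw [← h2]
  congr 1
  ext x
  rw [← mul_assoc, ← Complex.exp_add]
  congr 2
  push_cast
  ring

/-- continuous periodic with lowest frequency `m` and coefficient `c` there -/
structure LowFreq (φ : ℝ → ℂ) (m : ℤ) (c : ℂ) : Prop where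
  per : Function.Periodic φ 1
  cont : Continuous φ
  low : ∀ n < m, fourierCoefP φ n = 0
  eq : fourierCoefP φ m = c

lemma LowFreq.mul {φ ψ : ℝ → ℂ} {m m' : ℤ} {c c' : ℂ} (h : LowFreq φ m c) (h' : LowFreq ψ m' c') :
    LowFreq (fun x => φ x * ψ x) (m + m') (c * c') where
  per := fun x => by simp only [h.per x, h'.per x]
  cont := h.cont.mul h'.cont
  low := by
    intro n hn
    have := coef_mul φ ψ h.per h.cont h'.per h'.cont n
    refine this.unique ?_
    convert hasSum_zero using 2 with k
    by_cases hk : k < m'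
    · rw [h'.low k hk, mul_zero]
    · rw [h.low (n - k) (by omega), zero_mul]
  eq := by
    have := coef_mul φ ψ h.per h.cont h'.per h'.cont (m + m')
    have h2 := hasSum_single (f := fun k => fourierCoefP φ (m + m' - k) * fourierCoefP ψ k) m' (by
      intro k hk
      by_cases hk : k < m'
      · simp only [h'.low k hk, mul_zero]
      · simp only [h.low (m + m' - k) (by omega), zero_mul])
    rw [this.unique h2, h'.eq, add_sub_cancel_right, h.eq]

lemma LowFreq.prod {φ : ℕ → ℝ → ℂ} {m : ℤ} {c : ℕ → ℂ} (h : ∀ k, LowFreq (φ k) m (c k)) (N : ℕ) :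
    LowFreq (fun x => ∏ k ∈ Finset.range (N + 1), φ k x) ((N + 1) * m)
      (∏ k ∈ Finset.range (N + 1), c k) := by
  induction N with
  | zero => simpa using h 0
  | succ N ih =>
    have := ih.mul (h (N + 1))
    simp only [Finset.prod_range_succ _ (N + 1)]
    convert this using 1
    push_cast; ring

/-- Privalov-type uniqueness. -/
lemma analytic_unique (F : ℝ → ℂ) (hp : Function.Periodic F 1) (hc : Continuous F)
    (hneg : ∀ n < 0, fourierCoefP F n = 0) (a b : ℝ) (hab : a < b)
    (hz : ∀ x ∈ Set.Ioo a b, F x = 0) : ∀ x, F x = 0 := by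
  apply zero_of_coef F hp hc
  by_contra! hne
  obtain ⟨m, hm, hmin⟩ := Int.exists_least_of_bdd (P := fun n => fourierCoefP F n ≠ 0)
    ⟨0, fun z hz => by
      by_contra hlt
      exact hz (hneg z (by omega))⟩ hne
  obtain ⟨N, hN⟩ := exists_nat_one_div_lt (sub_pos.mpr hab)
  have hN0 : (0:ℝ) < (N : ℝ) + 1 := by positivity
  have hlow : ∀ k : ℕ, LowFreq (fun x => F (x + (k : ℝ) / (N + 1))) m
      (Complex.exp (2 * Real.pi * Complex.I * m * ((k : ℝ) / (N + 1) : ℝ)) * fourierCoefP F m) := by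
    intro k
    refine ⟨fun x => ?_, by fun_prop, fun n hn => ?_, ?_⟩
    · have := hp (x + (k : ℝ) / (N + 1))
      rw [← this]
      ring_nf
    · rw [coef_shift F hp]
      have : fourierCoefP F n = 0 := by
        by_contra h
        have := hmin n h
        omega
      rw [this, mul_zero]
    · rw [coef_shift F hp]
  have hprod := LowFreq.prod hlow N
  have hzero : ∀ x, (∏ k ∈ Finset.range (N + 1), F (x + (k : ℝ) / (N + 1))) = 0 := by
    intro x
    rw [Finset.prod_eq_zero_iff]
    -- find j integer with x + j/(N+1) in (a,b)
    obtain ⟨j, hj⟩ : ∃ j : ℤ, x + (j : ℝ) / (N + 1) ∈ Set.Ioo a b := by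
      refine ⟨⌊(a - x) * (N + 1)⌋ + 1, ?_, ?_⟩
      · have := Int.lt_floor_add_one ((a - x) * (N + 1))
        rw [← sub_lt_iff_lt_add', lt_div_iff₀ hN0]
        push_cast; exact this
      · have := Int.floor_le ((a - x) * (N + 1))
        have h3 : ((⌊(a - x) * (N + 1)⌋ + 1 : ℤ) : ℝ) / (N + 1) ≤ (a - x) + 1 / (N + 1) := by
          rw [div_le_iff₀ hN0, add_mul, one_div_mul_cancel hN0.ne']
          push_cast; linarith
        linarith
    have hNz : (0:ℤ) < (N:ℤ) + 1 := by positivity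
    refine ⟨(j % (N + 1)).toNat, ?_, ?_⟩
    · rw [Finset.mem_range]
      have := Int.emod_lt_of_pos j hNz
      have := Int.emod_nonneg j hNz.ne'
      omega
    · have h0 := Int.emod_nonneg j hNz.ne'
      have h1 : (((j % (N + 1)).toNat : ℕ) : ℝ) = ((j % (N + 1) : ℤ) : ℝ) := by
        rw [← Int.cast_natCast, Int.toNat_of_nonneg h0]
      have h2 : (j : ℝ) = ((j % (N + 1) : ℤ) : ℝ) + (N + 1) * ((j / (N + 1) : ℤ) : ℝ) := by
        exact_mod_cast (Int.emod_add_mul_ediv j (N + 1)).symm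
      have h4 := hz _ hj
      have h5 : x + (j : ℝ) / (N + 1) =
          x + (((j % (N + 1)).toNat : ℕ) : ℝ) / (N + 1) + ((j / (N + 1) : ℤ) : ℝ) * 1 := by
        rw [h1, h2]; field_simp; ring_nf
      rw [h5] at h4
      have h6 := (hp.int_mul (j / (N + 1))) (x + (((j % (N + 1)).toNat : ℕ) : ℝ) / (N + 1))
      rw [h6] at h4
      exact h4
  have := hprod.eq
  simp only [hzero] at this
  rw [fourierCoefP] at this
  simp only [mul_zero, intervalIntegral.integral_zero] at this
  have h3 := (Finset.prod_ne_zero_iff (s := Finset.range (N + 1))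
    (f := fun k : ℕ => (Complex.exp (2 * Real.pi * Complex.I * m * ((k : ℝ) / (N + 1) : ℝ)) * fourierCoefP F m))).mpr
    (fun k _ => mul_ne_zero (Complex.exp_ne_zero _) hm)
  exact h3 this.symm

lemma coef_deriv (φ φ' : ℝ → ℂ) (hd : ∀ x, HasDerivAt φ (φ' x) x) (hc : Continuous φ')
    (hp : Function.Periodic φ 1) (n : ℤ) :
    fourierCoefP φ' n = 2 * Real.pi * Complex.I * n * fourierCoefP φ n := by
  unfold fourierCoefP
  have he : ∀ x : ℝ, HasDerivAt (fun x : ℝ => Complex.exp (-2 * Real.pi * Complex.I * n * x))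
      (Complex.exp (-2 * Real.pi * Complex.I * n * x) * (-2 * Real.pi * Complex.I * n)) x := by
    intro x
    have h1 : HasDerivAt (fun x : ℝ => (-2 * Real.pi * Complex.I * n * x : ℂ))
        (-2 * Real.pi * Complex.I * n) x := by
      simpa using (Complex.ofRealCLM.hasDerivAt (x := x)).const_mul (-2 * Real.pi * Complex.I * n : ℂ)
    exact h1.cexp
  have := intervalIntegral.integral_mul_deriv_eq_deriv_mul (a := 0) (b := 1)
    (fun x _ => he x) (fun x _ => hd x)
    (by apply Continuous.intervalIntegrable; fun_prop) (hc.intervalIntegrable _ _)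
  rw [this]
  have h1 := hp 0
  have h2 := exp_int_periodic (-n) 0
  have h3 : Complex.exp (-2 * Real.pi * Complex.I * n * ((1:ℝ):ℂ)) = 1 := by
    convert h2 using 2 <;> push_cast <;> simp
  rw [zero_add] at h1
  rw [h3, h1]
  rw [← intervalIntegral.integral_const_mul]
  simp only [ofReal_zero, mul_zero, Complex.exp_zero, sub_self, zero_sub]
  rw [← intervalIntegral.integral_neg]
  congr 1
  ext x
  ring

lemma deriv_periodic (φ φ' : ℝ → ℝ) (hd : ∀ x, HasDerivAt φ (φ' x) x)
    (hp : Function.Periodic φ 1) : Function.Periodic φ' 1 := by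
  intro x
  have h1 := (hd (x + 1)).comp_add_const x 1
  have h2 : (fun y => φ (y + 1)) = φ := funext hp
  rw [h2] at h1
  exact h1.unique (hd x)

lemma cont_of_deriv (φ φ' : ℝ → ℝ) (hd : ∀ x, HasDerivAt φ (φ' x) x) : Continuous φ :=
  continuous_iff_continuousAt.mpr fun x => (hd x).continuousAt

lemma coef_deriv_real (φ φ' : ℝ → ℝ) (hd : ∀ x, HasDerivAt φ (φ' x) x) (hc : Continuous φ')
    (hp : Function.Periodic φ 1) (n : ℤ) :
    fourierCoefP (fun x => (φ' x : ℂ)) n =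
      2 * Real.pi * Complex.I * n * fourierCoefP (fun x => (φ x : ℂ)) n :=
  coef_deriv _ _ (fun x => (hd x).ofReal_comp) (by fun_prop) (fun x => by simp only [hp x]) n

lemma coef_sub (φ ψ : ℝ → ℝ) (hc : Continuous φ) (hc' : Continuous ψ) (n : ℤ) :
    fourierCoefP (fun x => ((φ x - ψ x : ℝ) : ℂ)) n =
      fourierCoefP (fun x => (φ x : ℂ)) n - fourierCoefP (fun x => (ψ x : ℂ)) n := by
  unfold fourierCoefP
  rw [← intervalIntegral.integral_sub]
  · congr 1
    ext x
    push_cast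
    ring
  · apply Continuous.intervalIntegrable; fun_prop
  · apply Continuous.intervalIntegrable; fun_prop

lemma hilbert_sub (g₁ g₂ h₁ h₂ : ℝ → ℝ) (hg₁ : Continuous g₁) (hg₂ : Continuous g₂)
    (hh₁ : Continuous h₁) (hh₂ : Continuous h₂)
    (H₁ : HasPeriodicHilbertTransform (fun x => (g₁ x : ℂ)) fun x => (h₁ x : ℂ))
    (H₂ : HasPeriodicHilbertTransform (fun x => (g₂ x : ℂ)) fun x => (h₂ x : ℂ)) :
    HasPeriodicHilbertTransform (fun x => ((g₁ x - g₂ x : ℝ) : ℂ))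
      fun x => ((h₁ x - h₂ x : ℝ) : ℂ) := by
  intro n
  rw [coef_sub _ _ hg₁ hg₂, coef_sub _ _ hh₁ hh₂, H₁ n, H₂ n]
  ring

/-- both `g` and its Hilbert transform vanish on an interval: `g = 0` -/
lemma hilbert_unique (g h : ℝ → ℝ) (hgp : Function.Periodic g 1) (hgc : Continuous g)
    (hhp : Function.Periodic h 1) (hhc : Continuous h)
    (H : HasPeriodicHilbertTransform (fun x => (g x : ℂ)) fun x => (h x : ℂ))
    (a b : ℝ) (hab : a < b) (hg0 : ∀ x ∈ Set.Ioo a b, g x = 0)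
    (hh0 : ∀ x ∈ Set.Ioo a b, h x = 0) : ∀ x, g x = 0 := by
  have key := analytic_unique (fun x => (g x : ℂ) + Complex.I * (h x : ℂ))
    (fun x => by simp only [hgp x, hhp x]) (by fun_prop) (by
      intro n hn
      have h1 : fourierCoefP (fun x => (g x : ℂ) + Complex.I * (h x : ℂ)) n =
          fourierCoefP (fun x => (g x : ℂ)) n +
            Complex.I * fourierCoefP (fun x => (h x : ℂ)) n := by
        unfold fourierCoefP
        rw [← intervalIntegral.integral_const_mul, ← intervalIntegral.integral_add]
        · congr 1
          ext x
          ring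
        · apply Continuous.intervalIntegrable; fun_prop
        · apply Continuous.intervalIntegrable; fun_prop
      rw [h1, H n, Int.sign_eq_neg_one_of_neg hn]
      push_cast
      linear_combination (fourierCoefP (fun x => (g x : ℂ)) n) * Complex.I_sq) a b hab
    (fun x hx => by simp only [hg0 x hx, hh0 x hx]; simp)
  intro x
  have := congrArg Complex.re (key x)
  simpa using this

lemma skew (w p q h : ℝ → ℝ) (hw : ∀ x, HasDerivAt w (p x) x) (hp : ∀ x, HasDerivAt p (q x) x)
    (hq : Continuous q) (hwp : Function.Periodic w 1)
    (hhp : Function.Periodic h 1) (hhc : Continuous h)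
    (H : HasPeriodicHilbertTransform (fun x => (q x : ℂ)) fun x => (h x : ℂ)) :
    ∫ x in (0:ℝ)..1, w x * h x = 0 := by
  have hwc := cont_of_deriv _ _ hw
  have hpc := cont_of_deriv _ _ hp
  have hpp := deriv_periodic _ _ hw hwp
  have key := parsevalP (fun x => (w x : ℂ)) (fun x => (h x : ℂ)) (fun x => by simp only [hwp x])
    (by fun_prop) (fun x => by simp only [hhp x]) (by fun_prop)
  have key2 := Complex.hasSum_re key
  have h0 : ∀ n, (conj (fourierCoefP (fun x => (w x : ℂ)) n) *
      fourierCoefP (fun x => (h x : ℂ)) n).re = 0 := by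
    intro n
    rw [H n, coef_deriv_real p q hp hq hpp, coef_deriv_real w p hw hpc hwp]
    set c := fourierCoefP (fun x => (w x : ℂ)) n
    have : conj c * (-Complex.I * (Int.sign n : ℂ) *
        (2 * Real.pi * Complex.I * n * (2 * Real.pi * Complex.I * n * c))) =
        (((Int.sign n : ℝ) * (2 * Real.pi * n) ^ 2 * Complex.normSq c : ℝ) : ℂ) * Complex.I := by
      push_cast
      rw [Complex.normSq_eq_conj_mul_self]
      linear_combination (-Complex.I * conj c * c * (Int.sign n : ℂ) * (2 * Real.pi * n) ^ 2) * Complex.I_sq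
    rw [this, Complex.re_ofReal_mul, Complex.I_re, mul_zero]
  simp only [h0] at key2
  have h1 := key2.unique hasSum_zero
  have h2 : (∫ x in (0:ℝ)..1, conj ((w x : ℂ)) * (h x : ℂ)) =
      ((∫ x in (0:ℝ)..1, w x * h x : ℝ) : ℂ) := by
    rw [← intervalIntegral.integral_ofReal]
    congr 1
    ext x
    simp
  rw [h2, Complex.ofReal_re] at h1
  exact h1

lemma hilbert_norm (p q h : ℝ → ℝ) (hp : ∀ x, HasDerivAt p (q x) x)
    (hq : Continuous q) (hpp : Function.Periodic p 1)
    (hhp : Function.Periodic h 1) (hhc : Continuous h)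
    (H : HasPeriodicHilbertTransform (fun x => (q x : ℂ)) fun x => (h x : ℂ)) :
    ∫ x in (0:ℝ)..1, q x ^ 2 = ∫ x in (0:ℝ)..1, h x ^ 2 := by
  have hqp := deriv_periodic _ _ hp hpp
  have k1 := parsevalP_self (fun x => (q x : ℂ)) (fun x => by simp only [hqp x]) (by fun_prop)
  have k2 := parsevalP_self (fun x => (h x : ℂ)) (fun x => by simp only [hhp x]) (by fun_prop)
  have h0 : ∀ n, ‖fourierCoefP (fun x => (h x : ℂ)) n‖ ^ 2 =
      ‖fourierCoefP (fun x => (q x : ℂ)) n‖ ^ 2 := by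
    intro n
    rcases lt_trichotomy n 0 with hn | hn | hn
    · rw [H n, Int.sign_eq_neg_one_of_neg hn]; simp
    · have := coef_deriv_real p q hp hq hpp n
      rw [H n, this, hn]; simp
    · rw [H n, Int.sign_eq_one_of_pos hn]; simp
  simp only [h0] at k2
  have := k1.unique k2
  simpa using this

lemma slice_bound (u p q h : ℝ → ℝ) (hu : ∀ x, HasDerivAt u (p x) x)
    (hp : ∀ x, HasDerivAt p (q x) x)
    (hq : Continuous q) (hup : Function.Periodic u 1)
    (hhp : Function.Periodic h 1) (hhc : Continuous h)
    (H : HasPeriodicHilbertTransform (fun x => (q x : ℂ)) fun x => (h x : ℂ))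
    (A B M : ℝ)
    (hM : ∀ x ∈ Set.Icc (0:ℝ) 1, |u x| ≤ M)
    (hAB : ∀ x ∈ Set.Icc (0:ℝ) 1, |h x| ≤ A + B * |p x|) :
    ∀ x ∈ Set.Icc (0:ℝ) 1, |p x| ≤ 1 + 4 * A ^ 2 + 4 * B ^ 4 * M ^ 2 := by
  have huc := cont_of_deriv _ _ hu
  have hpc := cont_of_deriv _ _ hp
  have hpp := deriv_periodic _ _ hu hup
  have hn := hilbert_norm p q h hp hq hpp hhp hhc H
  have hM2 : ∀ x ∈ Set.Icc (0:ℝ) 1, u x ^ 2 ≤ M ^ 2 := fun x hx =>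
    sq_le_sq.mpr ((hM x hx).trans (le_abs_self M))
  -- integration by parts
  have hpart : ∫ x in (0:ℝ)..1, (p x ^ 2 + u x * q x) = 0 := by
    have := intervalIntegral.integral_eq_sub_of_hasDerivAt (a := 0) (b := 1)
      (f := fun x => u x * p x) (f' := fun x => p x * p x + u x * q x)
      (fun x _ => (hu x).mul (hp x)) (by apply Continuous.intervalIntegrable; fun_prop)
    have e1 := hup 0
    have e2 := hpp 0
    rw [zero_add] at e1 e2
    simp only [e1, e2, sub_self] at this
    rw [← this]
    congr 1
    ext x
    ring
  have hmono : ∫ x in (0:ℝ)..1, h x ^ 2 ≤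
      ∫ x in (0:ℝ)..1, (2 * A ^ 2 + 2 * B ^ 4 * M ^ 2 + (1 / 2) * q x ^ 2 +
        2 * B ^ 2 * (p x ^ 2 + u x * q x)) := by
    apply intervalIntegral.integral_mono_on zero_le_one
    · apply Continuous.intervalIntegrable; fun_prop
    · apply Continuous.intervalIntegrable; fun_prop
    · intro x hx
      have h1 := hAB x hx
      have h2 : h x ^ 2 ≤ (A + B * |p x|) ^ 2 := by
        rw [← sq_abs (h x)]
        exact pow_le_pow_left₀ (abs_nonneg _) h1 2
      have h3 : (A + B * |p x|) ^ 2 ≤ 2 * A ^ 2 + 2 * B ^ 2 * p x ^ 2 := by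
        rw [← sq_abs (p x)]
        nlinarith [sq_nonneg (A - B * |p x|)]
      have h4 := hM2 x hx
      have h5 : B ^ 4 * u x ^ 2 ≤ B ^ 4 * M ^ 2 := mul_le_mul_of_nonneg_left h4 (by positivity)
      nlinarith [sq_nonneg (q x + 2 * B ^ 2 * u x)]
  have hsplit : ∫ x in (0:ℝ)..1, (2 * A ^ 2 + 2 * B ^ 4 * M ^ 2 + (1 / 2) * q x ^ 2 +
        2 * B ^ 2 * (p x ^ 2 + u x * q x)) = 2 * A ^ 2 + 2 * B ^ 4 * M ^ 2 +
        (1 / 2) * ∫ x in (0:ℝ)..1, q x ^ 2 := by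
    rw [intervalIntegral.integral_add, intervalIntegral.integral_add,
      intervalIntegral.integral_const_mul, intervalIntegral.integral_const_mul, hpart]
    · simp
    all_goals apply Continuous.intervalIntegrable; fun_prop
  have hQ : ∫ x in (0:ℝ)..1, q x ^ 2 ≤ 4 * A ^ 2 + 4 * B ^ 4 * M ^ 2 := by
    rw [hsplit, ← hn] at hmono
    linarith
  obtain ⟨c, hc, hpc0⟩ := exists_hasDerivAt_eq_zero (f := u) (f' := p) (a := 0) (b := 1) one_pos
    huc.continuousOn (by have := hup 0; rw [zero_add] at this; exact this.symm) (fun x _ => hu x)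
  intro x hx
  have e1 : ∫ y in c..x, q y = p x := by
    rw [intervalIntegral.integral_eq_sub_of_hasDerivAt (fun y _ => hp y)
      (hq.intervalIntegrable _ _), hpc0, sub_zero]
  rw [← e1]
  have e2 : |∫ y in c..x, q y| ≤ ∫ y in (0:ℝ)..1, |q y| := by
    rw [← Real.norm_eq_abs]
    refine (intervalIntegral.norm_integral_le_abs_integral_norm).trans ?_
    have h5 : ∫ y in (0:ℝ)..1, |q y| = |∫ y in (0:ℝ)..1, ‖q y‖| := by
      rw [abs_of_nonneg]
      · rfl
      · exact intervalIntegral.integral_nonneg zero_le_one fun _ _ => norm_nonneg _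
    rw [h5]
    apply intervalIntegral.abs_integral_mono_interval
    · rw [Set.uIoc_of_le zero_le_one, Set.uIoc]
      apply Set.Ioc_subset_Ioc
      · exact le_min hc.1.le hx.1
      · exact max_le hc.2.le hx.2
    · exact Eventually.of_forall fun _ => norm_nonneg _
    · apply Continuous.intervalIntegrable; fun_prop
  have e3 : ∫ y in (0:ℝ)..1, |q y| ≤ ∫ y in (0:ℝ)..1, (1 + q y ^ 2) := by
    apply intervalIntegral.integral_mono_on zero_le_one
    · apply Continuous.intervalIntegrable; fun_prop
    · apply Continuous.intervalIntegrable; fun_prop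
    · intro y _
      rw [← sq_abs (q y)]
      nlinarith [sq_nonneg (|q y| - 1), abs_nonneg (q y)]
  have e4 : ∫ y in (0:ℝ)..1, (1 + q y ^ 2) = 1 + ∫ y in (0:ℝ)..1, q y ^ 2 := by
    rw [intervalIntegral.integral_add]
    · simp
    all_goals apply Continuous.intervalIntegrable; fun_prop
  linarith

lemma energy_bound (f : ℝ → ℝ) (hf : ContDiff ℝ (⊤ : ℕ∞) f) (u₁ p₁ u₂ p₂ v : ℝ → ℝ)
    (hu₁ : ∀ x, HasDerivAt u₁ (p₁ x) x) (hu₂ : ∀ x, HasDerivAt u₂ (p₂ x) x)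
    (hp₁ : Continuous p₁) (hp₂ : Continuous p₂)
    (hup₁ : Function.Periodic u₁ 1) (hup₂ : Function.Periodic u₂ 1) (hv : Continuous v)
    (hwv : ∫ x in (0:ℝ)..1, (u₁ x - u₂ x) * v x = 0) (M L R : ℝ)
    (hM₁ : ∀ x ∈ Set.Icc (0:ℝ) 1, |u₁ x| ≤ M) (hM₂ : ∀ x ∈ Set.Icc (0:ℝ) 1, |u₂ x| ≤ M)
    (hL : ∀ y ∈ Set.Icc (-M) M, |deriv (deriv f) y| ≤ L)
    (hR₁ : ∀ x ∈ Set.Icc (0:ℝ) 1, |p₁ x| ≤ R) (hR₂ : ∀ x ∈ Set.Icc (0:ℝ) 1, |p₂ x| ≤ R) :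
    |∫ x in (0:ℝ)..1, 2 * (u₁ x - u₂ x) * (v x - deriv f (u₁ x) * p₁ x + deriv f (u₂ x) * p₂ x)| ≤
      3 * L * R * ∫ x in (0:ℝ)..1, (u₁ x - u₂ x) ^ 2 := by
  have hc₁ := cont_of_deriv _ _ hu₁
  have hc₂ := cont_of_deriv _ _ hu₂
  have hf1 : ContDiff ℝ (⊤ : ℕ∞) (deriv f) := (contDiff_infty_iff_deriv.mp hf).2
  have hf2 : ContDiff ℝ (⊤ : ℕ∞) (deriv (deriv f)) := (contDiff_infty_iff_deriv.mp hf1).2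
  have hd1 : Differentiable ℝ (deriv f) := (contDiff_infty_iff_deriv.mp hf1).1
  have hcf1 := hf1.continuous
  have hcf2 := hf2.continuous
  have hD : ∫ x in (0:ℝ)..1, (2 * (u₁ x - u₂ x) * (p₁ x - p₂ x) * deriv f (u₁ x) +
      (u₁ x - u₂ x) ^ 2 * (deriv (deriv f) (u₁ x) * p₁ x)) = 0 := by
    have := intervalIntegral.integral_eq_sub_of_hasDerivAt (a := 0) (b := 1)
      (f := fun x => (u₁ x - u₂ x) ^ 2 * deriv f (u₁ x))
      (f' := fun x => (2 * (u₁ x - u₂ x) * (p₁ x - p₂ x) * deriv f (u₁ x) +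
      (u₁ x - u₂ x) ^ 2 * (deriv (deriv f) (u₁ x) * p₁ x)))
      (fun x _ => by
        have h1 := ((hu₁ x).sub (hu₂ x)).pow 2
        have h2 := (hd1 (u₁ x)).hasDerivAt.comp x (hu₁ x)
        have h3 := h1.mul h2
        refine h3.congr_deriv ?_
        simp [Function.comp]) (by apply Continuous.intervalIntegrable; fun_prop)
    rw [this]
    have e1 := hup₁ 0
    have e2 := hup₂ 0
    rw [zero_add] at e1 e2
    rw [e1, e2, sub_self]
  have heq : ∫ x in (0:ℝ)..1, 2 * (u₁ x - u₂ x) *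
      (v x - deriv f (u₁ x) * p₁ x + deriv f (u₂ x) * p₂ x) =
      ∫ x in (0:ℝ)..1, ((u₁ x - u₂ x) ^ 2 * (deriv (deriv f) (u₁ x) * p₁ x) -
        2 * (u₁ x - u₂ x) * (deriv f (u₁ x) - deriv f (u₂ x)) * p₂ x) := by
    have : ∀ x, 2 * (u₁ x - u₂ x) *
      (v x - deriv f (u₁ x) * p₁ x + deriv f (u₂ x) * p₂ x) =
      2 * ((u₁ x - u₂ x) * v x) - (2 * (u₁ x - u₂ x) * (p₁ x - p₂ x) * deriv f (u₁ x) +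
      (u₁ x - u₂ x) ^ 2 * (deriv (deriv f) (u₁ x) * p₁ x)) +
      ((u₁ x - u₂ x) ^ 2 * (deriv (deriv f) (u₁ x) * p₁ x) -
        2 * (u₁ x - u₂ x) * (deriv f (u₁ x) - deriv f (u₂ x)) * p₂ x) := fun x => by ring
    simp only [this]
    rw [intervalIntegral.integral_add, intervalIntegral.integral_sub,
      intervalIntegral.integral_const_mul, hwv, hD]
    · simp
    all_goals apply Continuous.intervalIntegrable; fun_prop
  rw [heq, ← intervalIntegral.integral_const_mul, ← Real.norm_eq_abs]
  refine intervalIntegral.norm_integral_le_of_norm_le zero_le_one ?_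
    (by apply Continuous.intervalIntegrable; fun_prop)
  refine Eventually.of_forall fun x hx' => ?_
  have hx : x ∈ Set.Icc (0:ℝ) 1 := Set.Ioc_subset_Icc_self hx'
  have m1 : u₁ x ∈ Set.Icc (-M) M := abs_le.mp (hM₁ x hx)
  have m2 : u₂ x ∈ Set.Icc (-M) M := abs_le.mp (hM₂ x hx)
  have hL0 : 0 ≤ L := (abs_nonneg _).trans (hL _ m1)
  have hR0 : 0 ≤ R := (abs_nonneg _).trans (hR₁ _ hx)
  have hlip : |deriv f (u₁ x) - deriv f (u₂ x)| ≤ L * |u₁ x - u₂ x| := by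
    have := Convex.norm_image_sub_le_of_norm_deriv_le (𝕜 := ℝ) (f := deriv f)
      (s := Set.Icc (-M) M) (C := L) (fun y _ => hd1 y) (fun y hy => hL y hy)
      (convex_Icc _ _) m2 m1
    simpa [Real.norm_eq_abs] using this
  rw [Real.norm_eq_abs]
  refine (abs_sub _ _).trans ?_
  rw [abs_mul, abs_mul, abs_mul, abs_mul, abs_mul, abs_pow, abs_two]
  set W := |u₁ x - u₂ x| with hW
  have hW0 : 0 ≤ W := abs_nonneg _
  have hWsq : (u₁ x - u₂ x) ^ 2 = W ^ 2 := (sq_abs _).symm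
  rw [hWsq]
  have a1 : W ^ 2 * (|deriv (deriv f) (u₁ x)| * |p₁ x|) ≤ W ^ 2 * (L * R) := by
    have := hL _ m1
    have := hR₁ x hx
    gcongr
  have a2 : 2 * W * |deriv f (u₁ x) - deriv f (u₂ x)| * |p₂ x| ≤ 2 * W * (L * W) * R := by
    have := hR₂ x hx
    gcongr
  nlinarith

lemma gronwall_zero (E E' : ℝ → ℝ) (a b K t₀ : ℝ) (ht₀ : t₀ ∈ Set.Ioo a b)
    (hd : ∀ t ∈ Set.Ioo a b, HasDerivAt E (E' t) t)
    (hK : ∀ t ∈ Set.Ioo a b, |E' t| ≤ K * E t) (h0 : E t₀ = 0) (hE : ∀ t, 0 ≤ E t) :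
    ∀ t ∈ Set.Ioo a b, E t = 0 := by
  have hexp : ∀ (c t : ℝ), HasDerivAt (fun t => Real.exp (c * t)) (Real.exp (c * t) * c) t := by
    intro c t
    have : HasDerivAt (fun t => c * t) c t := by simpa using (hasDerivAt_id t).const_mul c
    exact this.exp
  intro t ht
  rcases le_total t₀ t with hle | hle
  · have hanti : AntitoneOn (fun t => Real.exp (-K * t) * E t) (Set.Ioo a b) := by
      apply antitoneOn_of_deriv_nonpos (convex_Ioo a b)
      · exact fun s hs => ((hexp (-K) s).mul (hd s hs)).continuousAt.continuousWithinAt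
      · rw [interior_Ioo]
        exact fun s hs => ((hexp (-K) s).mul (hd s hs)).differentiableAt.differentiableWithinAt
      · rw [interior_Ioo]
        intro s hs
        have : deriv (fun t => Real.exp (-K * t) * E t) s = _ :=
          ((hexp (-K) s).mul (hd s hs)).deriv
        rw [this]
        have h1 := (abs_le.mp (hK s hs)).2
        nlinarith [Real.exp_pos (-K * s)]
    have := hanti ht₀ ht hle
    simp only [h0, mul_zero] at this
    have h2 := Real.exp_pos (-K * t)
    have h3 := hE t
    nlinarith
  · have hmono : MonotoneOn (fun t => Real.exp (K * t) * E t) (Set.Ioo a b) := by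
      apply monotoneOn_of_deriv_nonneg (convex_Ioo a b)
      · exact fun s hs => ((hexp K s).mul (hd s hs)).continuousAt.continuousWithinAt
      · rw [interior_Ioo]
        exact fun s hs => ((hexp K s).mul (hd s hs)).differentiableAt.differentiableWithinAt
      · rw [interior_Ioo]
        intro s hs
        have : deriv (fun t => Real.exp (K * t) * E t) s = _ :=
          ((hexp K s).mul (hd s hs)).deriv
        rw [this]
        have h1 := (abs_le.mp (hK s hs)).1
        nlinarith [Real.exp_pos (K * s)]
    have := hmono ht ht₀ hle
    simp only [h0, mul_zero] at this
    have h2 := Real.exp_pos (K * t)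
    have h3 := hE t
    nlinarith

/-- uniform bounds of a solution on a compact time interval -/
lemma solution_bounds (T s : ℝ) (f : ℝ → ℝ) (hf : ContDiff ℝ (⊤ : ℕ∞) f)
    (u ux uxx ut v : ℝ → ℝ → ℝ) (h : IsPeriodicGBOSolution T s f u ux uxx ut v)
    (a b : ℝ) (ha : 0 < a) (hb : b < T) :
    ∃ M A R : ℝ, ∀ t ∈ Set.Icc a b, ∀ x ∈ Set.Icc (0:ℝ) 1,
      |u x t| ≤ M ∧ |ut x t| ≤ A ∧ |ux x t| ≤ R := by
  have hsub : Set.Icc a b ⊆ Set.Ioo 0 T := fun t ht => ⟨ha.trans_le ht.1, ht.2.trans_lt hb⟩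
  have hcpt : IsCompact (Set.Icc (0:ℝ) 1 ×ˢ Set.Icc a b) := isCompact_Icc.prod isCompact_Icc
  obtain ⟨M, hM⟩ := hcpt.exists_bound_of_continuousOn (h.cont.mono
    (Set.prod_mono (Set.subset_univ _) (hsub.trans Set.Ioo_subset_Icc_self)))
  obtain ⟨A, hA⟩ := hcpt.exists_bound_of_continuousOn (h.cont_ut.mono
    (Set.prod_mono (Set.subset_univ _) hsub))
  have hf1 : Continuous (deriv f) := (contDiff_infty_iff_deriv.mp hf).2.continuous
  obtain ⟨B, hB⟩ := (isCompact_Icc (a := -M) (b := M)).exists_bound_of_continuousOn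
    hf1.continuousOn
  refine ⟨M, A, 1 + 4 * A ^ 2 + 4 * B ^ 4 * M ^ 2, fun t ht x hx => ⟨?_, ?_, ?_⟩⟩
  · exact hM (x, t) ⟨hx, ht⟩
  · exact hA (x, t) ⟨hx, ht⟩
  · have ht' := hsub ht
    have ht'' := Set.Ioo_subset_Icc_self ht'
    refine slice_bound (fun x => u x t) (fun x => ux x t) (fun x => uxx x t) (fun x => v x t)
      (h.deriv_x t ht'') (h.deriv_xx t ht'') (h.cont_uxx t ht'') (h.periodic t ht'')
      (h.periodic_v t ht') (h.cont_v t ht') (h.hilbert t ht') A B M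
      (fun y hy => hM (y, t) ⟨hy, ht⟩) (fun y hy => ?_) x hx
    have e := h.equation y t ht'
    have e2 : v y t = ut y t + deriv f (u y t) * ux y t := by linarith
    have e3 : |ut y t| ≤ A := hA (y, t) ⟨hy, ht⟩
    have e4 : |deriv f (u y t)| ≤ B := hB _ (abs_le.mp (hM (y, t) ⟨hy, ht⟩))
    rw [e2]
    refine (abs_add_le _ _).trans ?_
    rw [abs_mul]
    gcongr

lemma slice_cont_ut (T s : ℝ) (f : ℝ → ℝ)
    (u ux uxx ut v : ℝ → ℝ → ℝ) (h : IsPeriodicGBOSolution T s f u ux uxx ut v)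
    (t : ℝ) (ht : t ∈ Set.Ioo 0 T) : Continuous fun x => ut x t := by
  have : ContinuousOn (fun x : ℝ => ut x t) Set.univ :=
    h.cont_ut.comp (f := fun x : ℝ => (x, t)) (by fun_prop) (fun x _ => ⟨trivial, ht⟩)
  simpa using this

lemma energy_deriv (T s : ℝ) (f : ℝ → ℝ) (hf : ContDiff ℝ (⊤ : ℕ∞) f)
    (u₁ ux₁ uxx₁ ut₁ v₁ u₂ ux₂ uxx₂ ut₂ v₂ : ℝ → ℝ → ℝ)
    (h₁ : IsPeriodicGBOSolution T s f u₁ ux₁ uxx₁ ut₁ v₁)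
    (h₂ : IsPeriodicGBOSolution T s f u₂ ux₂ uxx₂ ut₂ v₂)
    (t : ℝ) (ht : t ∈ Set.Ioo 0 T) :
    HasDerivAt (fun τ => ∫ x in (0:ℝ)..1, (u₁ x τ - u₂ x τ) ^ 2)
      (∫ x in (0:ℝ)..1, 2 * (u₁ x t - u₂ x t) * (ut₁ x t - ut₂ x t)) t := by
  have ha : 0 < t / 2 := by linarith [ht.1]
  have hb : (t + T) / 2 < T := by linarith [ht.2]
  obtain ⟨M₁, A₁, _, hb₁⟩ := solution_bounds T s f hf _ _ _ _ _ h₁ _ _ ha hb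
  obtain ⟨M₂, A₂, _, hb₂⟩ := solution_bounds T s f hf _ _ _ _ _ h₂ _ _ ha hb
  have hnhds : Set.Icc (t / 2) ((t + T) / 2) ∈ 𝓝 t :=
    Icc_mem_nhds (by linarith [ht.1]) (by linarith [ht.2])
  have hsub : ∀ τ ∈ Set.Icc (t / 2) ((t + T) / 2), τ ∈ Set.Ioo 0 T :=
    fun τ hτ => ⟨ha.trans_le hτ.1, hτ.2.trans_lt hb⟩
  have hcu : ∀ τ ∈ Set.Ioo 0 T, Continuous fun x => (u₁ x τ - u₂ x τ) := fun τ hτ =>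
    (cont_of_deriv _ _ (h₁.deriv_x τ (Set.Ioo_subset_Icc_self hτ))).sub
      (cont_of_deriv _ _ (h₂.deriv_x τ (Set.Ioo_subset_Icc_self hτ)))
  have hct := (slice_cont_ut T s f _ _ _ _ _ h₁ t ht).sub (slice_cont_ut T s f _ _ _ _ _ h₂ t ht)
  refine (intervalIntegral.hasDerivAt_integral_of_dominated_loc_of_deriv_le
    (F := fun τ x => (u₁ x τ - u₂ x τ) ^ 2)
    (F' := fun τ x => 2 * (u₁ x τ - u₂ x τ) * (ut₁ x τ - ut₂ x τ))
    (bound := fun _ => 2 * (M₁ + M₂) * (A₁ + A₂)) hnhds ?_ ?_ ?_ ?_ ?_ ?_).2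
  · filter_upwards [hnhds] with τ hτ
    exact ((hcu τ (hsub τ hτ)).pow 2).aestronglyMeasurable
  · exact ((hcu t ht).pow 2).intervalIntegrable _ _
  · exact ((continuous_const.mul (hcu t ht)).mul hct).aestronglyMeasurable
  · refine Eventually.of_forall fun x hx τ hτ => ?_
    rw [Set.uIoc_of_le zero_le_one] at hx
    have hx' := Set.Ioc_subset_Icc_self hx
    obtain ⟨m1, a1, -⟩ := hb₁ τ hτ x hx'
    obtain ⟨m2, a2, -⟩ := hb₂ τ hτ x hx'
    rw [norm_mul, norm_mul, Real.norm_eq_abs, Real.norm_eq_abs, Real.norm_eq_abs, abs_two]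
    have k1 := (abs_sub (u₁ x τ) (u₂ x τ)).trans (add_le_add m1 m2)
    have k2 := (abs_sub (ut₁ x τ) (ut₂ x τ)).trans (add_le_add a1 a2)
    have k3 := (abs_nonneg _).trans k1
    gcongr
  · exact intervalIntegrable_const
  · refine Eventually.of_forall fun x _ τ hτ => ?_
    have := ((h₁.deriv_t x τ (hsub τ hτ)).sub (h₂.deriv_t x τ (hsub τ hτ))).pow 2
    refine this.congr_deriv ?_
    simp

/-- **Unique continuation for the generalized Benjamin–Ono equation on the circle.** Let
`f : ℝ → ℝ` be smooth with `f(0) = 0`. If two solutions `u₁, u₂ ∈ C([0,T] : H^s(𝕊¹))`,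
`s > 5/2`, of `∂ₜu - ℋ∂ₓ²u + ∂ₓ(f(u)) = 0` (realized as `1`-periodic functions in `x`)
coincide on a nonempty open subset `Ω ⊆ 𝕊¹ × (0,T)`, then they coincide on all of
`𝕊¹ × [0,T]`. -/
theorem periodic_generalized_benjamin_ono_unique_continuation
    (T s : ℝ) (hT : 0 < T) (hs : 5 / 2 < s)
    (f : ℝ → ℝ) (hf : ContDiff ℝ (⊤ : ℕ∞) f) (hf0 : f 0 = 0)
    (u₁ ux₁ uxx₁ ut₁ v₁ u₂ ux₂ uxx₂ ut₂ v₂ : ℝ → ℝ → ℝ)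
    (h₁ : IsPeriodicGBOSolution T s f u₁ ux₁ uxx₁ ut₁ v₁)
    (h₂ : IsPeriodicGBOSolution T s f u₂ ux₂ uxx₂ ut₂ v₂)
    (Ω : Set (ℝ × ℝ)) (hΩ_open : IsOpen Ω) (hΩ_ne : Ω.Nonempty)
    (hΩ_sub : Ω ⊆ Set.univ ×ˢ Set.Ioo 0 T)
    (h_agree : ∀ p ∈ Ω, u₁ p.1 p.2 = u₂ p.1 p.2) :
    ∀ x : ℝ, ∀ t ∈ Set.Icc 0 T, u₁ x t = u₂ x t := by
  have _ := hs
  have _ := hf0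
  -- a box in Ω
  obtain ⟨⟨x₀, t₀⟩, hp₀⟩ := hΩ_ne
  obtain ⟨ε, hε, hball⟩ := Metric.isOpen_iff.mp hΩ_open _ hp₀
  have hbox : ∀ x ∈ Set.Ioo (x₀ - ε) (x₀ + ε), ∀ t ∈ Set.Ioo (t₀ - ε) (t₀ + ε),
      u₁ x t = u₂ x t := by
    intro x hx t ht
    refine h_agree (x, t) (hball ?_)
    rw [← Real.ball_eq_Ioo] at hx ht
    rw [← ball_prod_same]
    exact ⟨hx, ht⟩
  have ht₀ : t₀ ∈ Set.Ioo 0 T := (hΩ_sub hp₀).2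
  have ht₀' := Set.Ioo_subset_Icc_self ht₀
  have htε : t₀ ∈ Set.Ioo (t₀ - ε) (t₀ + ε) := ⟨by linarith, by linarith⟩
  -- derivatives agree on the interval at time t₀
  have hux : ∀ x ∈ Set.Ioo (x₀ - ε) (x₀ + ε), ux₁ x t₀ = ux₂ x t₀ := by
    intro x hx
    refine (h₁.deriv_x t₀ ht₀' x).unique ((h₂.deriv_x t₀ ht₀' x).congr_of_eventuallyEq ?_)
    filter_upwards [isOpen_Ioo.mem_nhds hx] with y hy using hbox y hy t₀ htε
  have huxx : ∀ x ∈ Set.Ioo (x₀ - ε) (x₀ + ε), uxx₁ x t₀ = uxx₂ x t₀ := by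
    intro x hx
    refine (h₁.deriv_xx t₀ ht₀' x).unique ((h₂.deriv_xx t₀ ht₀' x).congr_of_eventuallyEq ?_)
    filter_upwards [isOpen_Ioo.mem_nhds hx] with y hy using hux y hy
  have hut : ∀ x ∈ Set.Ioo (x₀ - ε) (x₀ + ε), ut₁ x t₀ = ut₂ x t₀ := by
    intro x hx
    refine (h₁.deriv_t x t₀ ht₀).unique ((h₂.deriv_t x t₀ ht₀).congr_of_eventuallyEq ?_)
    filter_upwards [isOpen_Ioo.mem_nhds htε] with τ hτ using hbox x hx τ hτ
  have hv : ∀ x ∈ Set.Ioo (x₀ - ε) (x₀ + ε), v₁ x t₀ = v₂ x t₀ := by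
    intro x hx
    have e1 := h₁.equation x t₀ ht₀
    have e2 := h₂.equation x t₀ ht₀
    rw [hux x hx, hut x hx, hbox x hx t₀ htε] at e1
    linarith
  -- periodicity of second derivatives
  have hpx₁ : ∀ t ∈ Set.Icc 0 T, Function.Periodic (fun x => ux₁ x t) 1 := fun t ht =>
    deriv_periodic _ _ (h₁.deriv_x t ht) (h₁.periodic t ht)
  have hpx₂ : ∀ t ∈ Set.Icc 0 T, Function.Periodic (fun x => ux₂ x t) 1 := fun t ht =>
    deriv_periodic _ _ (h₂.deriv_x t ht) (h₂.periodic t ht)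
  have hpxx₁ := deriv_periodic _ _ (h₁.deriv_xx t₀ ht₀') (hpx₁ t₀ ht₀')
  have hpxx₂ := deriv_periodic _ _ (h₂.deriv_xx t₀ ht₀') (hpx₂ t₀ ht₀')
  have hxx0 : ∀ x, uxx₁ x t₀ - uxx₂ x t₀ = 0 :=
    hilbert_unique (fun x => uxx₁ x t₀ - uxx₂ x t₀) (fun x => v₁ x t₀ - v₂ x t₀)
      (hpxx₁.sub hpxx₂) ((h₁.cont_uxx t₀ ht₀').sub (h₂.cont_uxx t₀ ht₀'))
      ((h₁.periodic_v t₀ ht₀).sub (h₂.periodic_v t₀ ht₀))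
      ((h₁.cont_v t₀ ht₀).sub (h₂.cont_v t₀ ht₀))
      (hilbert_sub _ _ _ _ (h₁.cont_uxx t₀ ht₀') (h₂.cont_uxx t₀ ht₀') (h₁.cont_v t₀ ht₀)
        (h₂.cont_v t₀ ht₀) (h₁.hilbert t₀ ht₀) (h₂.hilbert t₀ ht₀))
      (x₀ - ε) (x₀ + ε) (by linarith)
      (fun x hx => sub_eq_zero.mpr (huxx x hx)) (fun x hx => sub_eq_zero.mpr (hv x hx))
  have hx₀ : x₀ ∈ Set.Ioo (x₀ - ε) (x₀ + ε) := ⟨by linarith, by linarith⟩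
  have hx0 : ∀ x, ux₁ x t₀ - ux₂ x t₀ = 0 := by
    intro x
    have hd : ∀ y, HasDerivAt (fun x => ux₁ x t₀ - ux₂ x t₀) 0 y := fun y => by
      have := (h₁.deriv_xx t₀ ht₀' y).sub (h₂.deriv_xx t₀ ht₀' y)
      rw [hxx0 y] at this
      exact this
    have := is_const_of_deriv_eq_zero (fun y => (hd y).differentiableAt) (fun y => (hd y).deriv) x x₀
    rw [this, hux x₀ hx₀, sub_self]
  have hw0 : ∀ x, u₁ x t₀ - u₂ x t₀ = 0 := by
    intro x
    have hd : ∀ y, HasDerivAt (fun x => u₁ x t₀ - u₂ x t₀) 0 y := fun y => by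
      have := (h₁.deriv_x t₀ ht₀' y).sub (h₂.deriv_x t₀ ht₀' y)
      rw [hx0 y] at this
      exact this
    have := is_const_of_deriv_eq_zero (fun y => (hd y).differentiableAt) (fun y => (hd y).deriv) x x₀
    rw [this, hbox x₀ hx₀ t₀ htε, sub_self]
  -- energy argument
  have hopen : ∀ t ∈ Set.Ioo 0 T, ∀ x, u₁ x t = u₂ x t := by
    intro t ht
    set a := min t t₀ / 2 with ha_def
    set b := (max t t₀ + T) / 2 with hb_def
    have hmin : 0 < min t t₀ := lt_min ht.1 ht₀.1
    have hmax : max t t₀ < T := max_lt ht.2 ht₀.2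
    have ha : 0 < a := by positivity
    have hb : b < T := by linarith
    have hta : t ∈ Set.Ioo a b := ⟨by linarith [min_le_left t t₀], by linarith [le_max_left t t₀]⟩
    have ht₀a : t₀ ∈ Set.Ioo a b :=
      ⟨by linarith [min_le_right t t₀], by linarith [le_max_right t t₀]⟩
    obtain ⟨M₁, A₁, R₁, hb₁⟩ := solution_bounds T s f hf _ _ _ _ _ h₁ a b ha hb
    obtain ⟨M₂, A₂, R₂, hb₂⟩ := solution_bounds T s f hf _ _ _ _ _ h₂ a b ha hb
    have hf1 : ContDiff ℝ (⊤ : ℕ∞) (deriv f) := (contDiff_infty_iff_deriv.mp hf).2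
    have hf2 : ContDiff ℝ (⊤ : ℕ∞) (deriv (deriv f)) := (contDiff_infty_iff_deriv.mp hf1).2
    obtain ⟨L, hL⟩ := (isCompact_Icc (a := -(max M₁ M₂)) (b := max M₁ M₂)).exists_bound_of_continuousOn
      hf2.continuous.continuousOn
    have hE := gronwall_zero (fun τ => ∫ x in (0:ℝ)..1, (u₁ x τ - u₂ x τ) ^ 2)
      (fun τ => ∫ x in (0:ℝ)..1, 2 * (u₁ x τ - u₂ x τ) * (ut₁ x τ - ut₂ x τ)) a b
      (3 * L * max R₁ R₂) t₀ ht₀a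
      (fun τ hτ => energy_deriv T s f hf _ _ _ _ _ _ _ _ _ _ h₁ h₂ τ
        ⟨ha.trans hτ.1, hτ.2.trans hb⟩)
      (fun τ hτ => by
        have hτ₀ : τ ∈ Set.Ioo 0 T := ⟨ha.trans hτ.1, hτ.2.trans hb⟩
        have hτ₀' := Set.Ioo_subset_Icc_self hτ₀
        have hτ' := Set.Ioo_subset_Icc_self hτ
        have hsk := skew (fun x => u₁ x τ - u₂ x τ) (fun x => ux₁ x τ - ux₂ x τ)
          (fun x => uxx₁ x τ - uxx₂ x τ) (fun x => v₁ x τ - v₂ x τ)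
          (fun x => (h₁.deriv_x τ hτ₀' x).sub (h₂.deriv_x τ hτ₀' x))
          (fun x => (h₁.deriv_xx τ hτ₀' x).sub (h₂.deriv_xx τ hτ₀' x))
          ((h₁.cont_uxx τ hτ₀').sub (h₂.cont_uxx τ hτ₀'))
          ((h₁.periodic τ hτ₀').sub (h₂.periodic τ hτ₀'))
          ((h₁.periodic_v τ hτ₀).sub (h₂.periodic_v τ hτ₀))
          ((h₁.cont_v τ hτ₀).sub (h₂.cont_v τ hτ₀))
          (hilbert_sub _ _ _ _ (h₁.cont_uxx τ hτ₀') (h₂.cont_uxx τ hτ₀') (h₁.cont_v τ hτ₀)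
            (h₂.cont_v τ hτ₀) (h₁.hilbert τ hτ₀) (h₂.hilbert τ hτ₀))
        have key := energy_bound f hf (fun x => u₁ x τ) (fun x => ux₁ x τ) (fun x => u₂ x τ)
          (fun x => ux₂ x τ) (fun x => v₁ x τ - v₂ x τ)
          (h₁.deriv_x τ hτ₀') (h₂.deriv_x τ hτ₀')
          (cont_of_deriv _ _ (h₁.deriv_xx τ hτ₀')) (cont_of_deriv _ _ (h₂.deriv_xx τ hτ₀'))
          (h₁.periodic τ hτ₀') (h₂.periodic τ hτ₀')
          ((h₁.cont_v τ hτ₀).sub (h₂.cont_v τ hτ₀)) hsk (max M₁ M₂) L (max R₁ R₂)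
          (fun x hx => (hb₁ τ hτ' x hx).1.trans (le_max_left _ _))
          (fun x hx => (hb₂ τ hτ' x hx).1.trans (le_max_right _ _))
          hL
          (fun x hx => (hb₁ τ hτ' x hx).2.2.trans (le_max_left _ _))
          (fun x hx => (hb₂ τ hτ' x hx).2.2.trans (le_max_right _ _))
        have heq : ∀ x, ut₁ x τ - ut₂ x τ = v₁ x τ - v₂ x τ - deriv f (u₁ x τ) * ux₁ x τ +
            deriv f (u₂ x τ) * ux₂ x τ := fun x => by
          have e1 := h₁.equation x τ hτ₀
          have e2 := h₂.equation x τ hτ₀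
          linarith
        simp only [heq]
        exact key)
      (by simp only [hw0]; simp)
      (fun τ => intervalIntegral.integral_nonneg zero_le_one fun x _ => sq_nonneg _) t hta
    have ht' := Set.Ioo_subset_Icc_self ht
    intro x
    have hz := zero_of_integral_zero (fun x => (u₁ x t - u₂ x t) ^ 2)
      (fun y => by
        have e1 := h₁.periodic t ht' y
        have e2 := h₂.periodic t ht' y
        simp only at e1 e2
        simp only [e1, e2])
      (((cont_of_deriv _ _ (h₁.deriv_x t ht')).sub (cont_of_deriv _ _ (h₂.deriv_x t ht'))).pow 2)
      (fun y => sq_nonneg _) hE x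
    exact sub_eq_zero.mp (pow_eq_zero_iff two_ne_zero |>.mp hz)
  -- extend to the closed interval
  intro x
  have hc : ∀ u : ℝ → ℝ → ℝ, ContinuousOn (fun p : ℝ × ℝ => u p.1 p.2)
      (Set.univ ×ˢ Set.Icc 0 T) → ContinuousOn (fun t => u x t) (Set.Icc 0 T) := by
    intro u hu
    exact hu.comp (f := fun t : ℝ => (x, t)) (by fun_prop) (fun t ht => ⟨trivial, ht⟩)
  have hEq : Set.EqOn (fun t => u₁ x t) (fun t => u₂ x t) (Set.Ioo 0 T) :=
    fun t ht => hopen t ht x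
  exact hEq.of_subset_closure (hc u₁ h₁.cont) (hc u₂ h₂.cont) Set.Ioo_subset_Icc_self
    (by rw [closure_Ioo hT.ne])
end
end

section
/- Let T > 0, s > 5/2, let f : ℝ → ℝ be infinitely differentiable with f(0) = 0, and let u₁, u₂ : 𝕊¹ × [0,T] → ℝ (with 𝕊¹ ≅ ℝ/ℤ, identified with [-1/2, 1/2]) be solutions of the generalized Benjamin–Ono equation ∂ₜu - ℋ∂ₓ²u + ∂ₓ(f(u)) = 0 on 𝕊¹ × [0,T], in the following sense: each uᵢ is continuous on 𝕊¹ × [0,T], differentiable in t on 𝕊¹ × [0,T) (one-sided at t = 0) with ∂ₜuᵢ continuous; for every t ∈ [0,T] the function uᵢ(·,t) belongs to H^s(𝕊¹), is twice continuously differentiable in x; and for every (x,t) ∈ 𝕊¹ × [0,T), ∂ₜuᵢ(x,t) - vᵢ(x,t) + f′(uᵢ(x,t))·∂ₓuᵢ(x,t) = 0, where vᵢ(·,t) is the continuous representative of ℋ(∂ₓ²uᵢ(·,t)). Suppose there exists an open set I ⊆ [-1/2, 1/2] with 0 ∈ I such that u₁(x,0) = u₂(x,0) for all x ∈ I, and that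 for every positive integer N there exist constants c_N > 0 and R_N > 0 such that ∫_{|x| ≤ R} |∂ₜu₁(x,0) - ∂ₜu₂(x,0)|² dx ≤ c_N·R^N for all 0 < R ≤ R_N. Then u₁(x,t) = u₂(x,t) for all (x,t) ∈ 𝕊¹ × [0,T]. -/
open MeasureTheory Complex Filter Topology

noncomputable section

/-- `IsPeriodicGBOSolution' T s f u ux uxx ut v` : `u : 𝕊¹ × [0,T] → ℝ` (realized as a
`1`-periodic function of `x ∈ ℝ`, with `𝕊¹ = ℝ/ℤ` identified with `[-1/2, 1/2]`) is a
solution of the generalized Benjamin–Ono equation `∂ₜu - ℋ∂ₓ²u + ∂ₓ(f(u)) = 0`, i.e.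
`∂ₜu - ℋ∂ₓ²u + f′(u)·∂ₓu = 0`, differentiable in `t` on `[0,T)` (one-sided at `t = 0`) with
`∂ₜu` continuous there, where `ux, uxx` are the first and second spatial derivatives, `ut` is
the time derivative, and `v(·,t)` is the continuous representative of the periodic Hilbert
transform `ℋ(∂ₓ²u(·,t))`. -/
structure IsPeriodicGBOSolution' (T s : ℝ) (f : ℝ → ℝ) (u ux uxx ut v : ℝ → ℝ → ℝ) : Prop where
  periodic : ∀ t ∈ Set.Icc 0 T, Function.Periodic (fun x => u x t) 1
  cont : ContinuousOn (fun p : ℝ × ℝ => u p.1 p.2) (Set.univ ×ˢ Set.Icc 0 T)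
  deriv_t : ∀ x : ℝ, ∀ t ∈ Set.Ico 0 T,
    HasDerivWithinAt (fun τ => u x τ) (ut x t) (Set.Icc 0 T) t
  cont_ut : ContinuousOn (fun p : ℝ × ℝ => ut p.1 p.2) (Set.univ ×ˢ Set.Ico 0 T)
  sobolev : ∀ t ∈ Set.Icc 0 T, MemHsP s fun x => (u x t : ℂ)
  deriv_x : ∀ t ∈ Set.Icc 0 T, ∀ x : ℝ, HasDerivAt (fun y => u y t) (ux x t) x
  deriv_xx : ∀ t ∈ Set.Icc 0 T, ∀ x : ℝ, HasDerivAt (fun y => ux y t) (uxx x t) x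
  cont_uxx : ∀ t ∈ Set.Icc 0 T, Continuous fun x => uxx x t
  periodic_v : ∀ t ∈ Set.Ico 0 T, Function.Periodic (fun x => v x t) 1
  cont_v : ∀ t ∈ Set.Ico 0 T, Continuous fun x => v x t
  hilbert : ∀ t ∈ Set.Ico 0 T,
    HasPeriodicHilbertTransform (fun x => (uxx x t : ℂ)) fun x => (v x t : ℂ)
  equation : ∀ x : ℝ, ∀ t ∈ Set.Ico 0 T,
    ut x t - v x t + deriv f (u x t) * ux x t = 0

lemma aux_parseval {f : ℝ → ℂ} (hf : Continuous f) :
    HasSum (fun n : ℤ => ‖fourierCoefP f n‖ ^ 2) (∫ x in (0:ℝ)..1, ‖f x‖ ^ 2) := by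
  have hL : MemLp f 2 (volume.restrict (Set.Ioc 0 1)) := by
    obtain ⟨C, hC⟩ := (isCompact_Icc (a := (0:ℝ)) (b := 1)).exists_bound_of_continuousOn
      hf.continuousOn
    refine MemLp.of_bound hf.aestronglyMeasurable C ?_
    exact (ae_restrict_iff' measurableSet_Ioc).2
      (Eventually.of_forall fun x hx => hC x (Set.Ioc_subset_Icc_self hx))
  have h := hasSum_sq_fourierCoeffOn (zero_lt_one' ℝ) hL
  simp only [sub_zero, inv_one, one_smul] at h
  convert h using 4 with n
  rw [fourierCoeffOn_eq_integral]
  simp only [sub_zero, div_one, one_smul, fourierCoefP]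
  refine intervalIntegral.integral_congr fun x _ => ?_
  simp only [smul_eq_mul]
  congr 1
  rw [fourier_coe_apply]
  congr 1
  push_cast
  ring

lemma aux_intble {f : ℝ → ℂ} (hf : Continuous f) (n : ℤ) :
    IntervalIntegrable (fun x : ℝ => Complex.exp (-2 * Real.pi * Complex.I * n * x) * f x)
      volume 0 1 := by
  apply Continuous.intervalIntegrable
  fun_prop

lemma aux_coef_add {f g : ℝ → ℂ} (hf : Continuous f) (hg : Continuous g) (n : ℤ) :
    fourierCoefP (fun x => f x + g x) n = fourierCoefP f n + fourierCoefP g n := by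
  unfold fourierCoefP
  rw [← intervalIntegral.integral_add (aux_intble hf n) (aux_intble hg n)]
  simp only [mul_add]

lemma aux_coef_sub {f g : ℝ → ℂ} (hf : Continuous f) (hg : Continuous g) (n : ℤ) :
    fourierCoefP (fun x => f x - g x) n = fourierCoefP f n - fourierCoefP g n := by
  unfold fourierCoefP
  rw [← intervalIntegral.integral_sub (aux_intble hf n) (aux_intble hg n)]
  simp only [mul_sub]

lemma aux_coef_deriv {u ux : ℝ → ℝ} (hu : ∀ x, HasDerivAt u (ux x) x) (hux : Continuous ux)
    (hper : u 1 = u 0) (n : ℤ) :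
    fourierCoefP (fun x => (ux x : ℂ)) n =
      (2 * Real.pi * Complex.I * n) * fourierCoefP (fun x => (u x : ℂ)) n := by
  unfold fourierCoefP
  have he : ∀ x : ℝ, HasDerivAt (fun x : ℝ => Complex.exp (-2 * Real.pi * Complex.I * n * x))
      (Complex.exp (-2 * Real.pi * Complex.I * n * x) * (-2 * Real.pi * Complex.I * n)) x := by
    intro x
    have h1 : HasDerivAt (fun x : ℝ => (-2 * Real.pi * Complex.I * n * (x : ℂ)))
        (-2 * Real.pi * Complex.I * n) x := by
      simpa using (Complex.ofRealCLM.hasDerivAt (x := x)).const_mul (-2 * Real.pi * Complex.I * n)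
    exact h1.cexp
  have hexp1 : Complex.exp (-2 * Real.pi * Complex.I * n * (1:ℝ)) = 1 := by
    rw [Complex.exp_eq_one_iff]
    exact ⟨-n, by push_cast; ring⟩
  have := intervalIntegral.integral_mul_deriv_eq_deriv_mul (a := (0:ℝ)) (b := 1)
    (u := fun x : ℝ => Complex.exp (-2 * Real.pi * Complex.I * n * x))
    (v := fun x => (u x : ℂ)) (v' := fun x => (ux x : ℂ))
    (fun x _ => he x) (fun x _ => (hu x).ofReal_comp)
    (by apply Continuous.intervalIntegrable; fun_prop)
    (by apply Continuous.intervalIntegrable; fun_prop)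
  rw [this, hexp1, hper, ← intervalIntegral.integral_const_mul]
  simp only [ofReal_zero, mul_zero, Complex.exp_zero, sub_self, zero_sub]
  rw [← intervalIntegral.integral_neg]
  refine intervalIntegral.integral_congr fun x _ => ?_
  ring

lemma aux_norm_sq_real (v : ℝ → ℝ) : (fun x => ‖(v x : ℂ)‖ ^ 2) = fun x => v x ^ 2 := by
  funext x
  rw [Complex.norm_real, Real.norm_eq_abs, sq_abs]

lemma aux_coef_zero {g G : ℝ → ℝ} (hG : ∀ x, HasDerivAt G (g x) x) (hg : Continuous g)
    (hper : G 1 = G 0) : fourierCoefP (fun x => (g x : ℂ)) 0 = 0 := by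
  rw [aux_coef_deriv hG hg hper]
  simp

lemma aux_hilbert_L2 {g v G : ℝ → ℝ} (hG : ∀ x, HasDerivAt G (g x) x) (hg : Continuous g)
    (hper : G 1 = G 0) (hv : Continuous v)
    (hH : HasPeriodicHilbertTransform (fun x => (g x : ℂ)) fun x => (v x : ℂ)) :
    ∫ x in (0:ℝ)..1, v x ^ 2 = ∫ x in (0:ℝ)..1, g x ^ 2 := by
  have h1 := aux_parseval (f := fun x => (v x : ℂ)) (by fun_prop)
  have h2 := aux_parseval (f := fun x => (g x : ℂ)) (by fun_prop)
  rw [aux_norm_sq_real] at h1 h2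
  refine h1.unique (h2.congr_fun ?_)
  intro n
  rw [hH n]
  rcases lt_trichotomy n 0 with hn | hn | hn
  · simp [Int.sign_eq_neg_one_of_neg hn]
  · subst hn
    simp [aux_coef_zero hG hg hper]
  · simp [Int.sign_eq_one_of_pos hn]

lemma aux_skew {w wx wxx v : ℝ → ℝ} (hw : ∀ x, HasDerivAt w (wx x) x)
    (hwx : ∀ x, HasDerivAt wx (wxx x) x) (hwxx : Continuous wxx) (hv : Continuous v)
    (hp : w 1 = w 0) (hpx : wx 1 = wx 0)
    (hH : HasPeriodicHilbertTransform (fun x => (wxx x : ℂ)) fun x => (v x : ℂ)) :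
    ∫ x in (0:ℝ)..1, w x * v x = 0 := by
  have cwx : Continuous wx := continuous_iff_continuousAt.2 fun x => (hwx x).continuousAt
  have cw : Continuous w := continuous_iff_continuousAt.2 fun x => (hw x).continuousAt
  have h1 := aux_parseval (f := fun x => ((w x + v x : ℝ) : ℂ)) (by fun_prop)
  have h2 := aux_parseval (f := fun x => ((w x - v x : ℝ) : ℂ)) (by fun_prop)
  rw [aux_norm_sq_real] at h1 h2
  have key : ∫ x in (0:ℝ)..1, (w x + v x) ^ 2 = ∫ x in (0:ℝ)..1, (w x - v x) ^ 2 := by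
    refine h1.unique (h2.congr_fun ?_)
    intro n
    simp only [ofReal_add, ofReal_sub]
    rw [aux_coef_add (by fun_prop) (by fun_prop), aux_coef_sub (by fun_prop) (by fun_prop), hH n,
      aux_coef_deriv hwx hwxx hpx, aux_coef_deriv hw cwx hp]
    set a := fourierCoefP (fun x => (w x : ℂ)) n
    set r : ℝ := (Int.sign n : ℝ) * (2 * Real.pi * n) ^ 2 with hr
    have e : -Complex.I * (Int.sign n : ℂ) * (2 * Real.pi * Complex.I * n *
        (2 * Real.pi * Complex.I * n * a)) = (r * Complex.I) * a := by
      rw [hr]; push_cast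
      linear_combination (-(Complex.I * (Int.sign n : ℂ) * (2 * Real.pi * n)^2 * a)) * Complex.I_sq
    rw [e, show a + r * Complex.I * a = (1 + r * Complex.I) * a by ring,
      show a - r * Complex.I * a = (1 - r * Complex.I) * a by ring, norm_mul, norm_mul, mul_pow,
      mul_pow]
    congr 1
    rw [← Complex.normSq_eq_norm_sq, ← Complex.normSq_eq_norm_sq]
    simp [Complex.normSq_apply]
  have i1 : IntervalIntegrable (fun x => (w x + v x) ^ 2) volume 0 1 := by
    apply Continuous.intervalIntegrable; fun_prop
  have i2 : IntervalIntegrable (fun x => (w x - v x) ^ 2) volume 0 1 := by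
    apply Continuous.intervalIntegrable; fun_prop
  have h4 : ∫ x in (0:ℝ)..1, 4 * (w x * v x) = 0 := by
    have h5 := intervalIntegral.integral_sub i1 i2
    rw [key, sub_self] at h5
    rw [← h5]
    congr 1
    funext x
    ring
  rw [intervalIntegral.integral_const_mul] at h4
  linarith

lemma aux_ux_bound {u ux uxx v : ℝ → ℝ} {a : ℝ → ℝ} {M0 M1 M2 : ℝ}
    (hu : ∀ x, HasDerivAt u (ux x) x)
    (hux : ∀ x, HasDerivAt ux (uxx x) x) (huxx : Continuous uxx) (hv : Continuous v)
    (hp : u 1 = u 0) (hpx : ux 1 = ux 0)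
    (hH : HasPeriodicHilbertTransform (fun x => (uxx x : ℂ)) fun x => (v x : ℂ))
    (h0 : ∀ x ∈ Set.Icc (0:ℝ) 1, |u x| ≤ M0) (h1 : ∀ x ∈ Set.Icc (0:ℝ) 1, |a x| ≤ M1)
    (h2 : ∀ x ∈ Set.Icc (0:ℝ) 1, |v x - a x * ux x| ≤ M2) :
    ∀ x ∈ Set.Icc (0:ℝ) 1, |ux x| ≤ 1 + (4 * M2 ^ 2 + 4 * M1 ^ 2 * ((M1 ^ 2 + 1) * M0 ^ 2)) := by
  have cux : Continuous ux := continuous_iff_continuousAt.2 fun x => (hux x).continuousAt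
  have cu : Continuous u := continuous_iff_continuousAt.2 fun x => (hu x).continuousAt
  set lam : ℝ := M1 ^ 2 + 1 with hlam
  have hlpos : 0 < lam := by positivity
  set A := ∫ x in (0:ℝ)..1, uxx x ^ 2 with hA
  set B := ∫ x in (0:ℝ)..1, ux x ^ 2 with hB
  have hA0 : 0 ≤ A := intervalIntegral.integral_nonneg zero_le_one fun x _ => sq_nonneg _
  have e1 : ∫ x in (0:ℝ)..1, v x ^ 2 = A := aux_hilbert_L2 hux huxx hpx hv hH
  have ineq1 : A ≤ 2 * M2 ^ 2 + 2 * M1 ^ 2 * B := by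
    rw [← e1]
    have : ∫ x in (0:ℝ)..1, v x ^ 2 ≤ ∫ x in (0:ℝ)..1, (2 * M2 ^ 2 + 2 * M1 ^ 2 * ux x ^ 2) := by
      refine intervalIntegral.integral_mono_on zero_le_one ?_ ?_ fun x hx => ?_
      · apply Continuous.intervalIntegrable; fun_prop
      · apply Continuous.intervalIntegrable; fun_prop
      · have b1 := sq_le_sq' (abs_le.1 (h1 x hx)).1 (abs_le.1 (h1 x hx)).2
        have b2 := sq_le_sq' (abs_le.1 (h2 x hx)).1 (abs_le.1 (h2 x hx)).2
        have b3 : a x ^ 2 * ux x ^ 2 ≤ M1 ^ 2 * ux x ^ 2 :=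
          mul_le_mul_of_nonneg_right b1 (sq_nonneg _)
        nlinarith [sq_nonneg (v x - a x * ux x - a x * ux x)]
    refine this.trans (le_of_eq ?_)
    rw [intervalIntegral.integral_add (by apply Continuous.intervalIntegrable; fun_prop)
      (by apply Continuous.intervalIntegrable; fun_prop), intervalIntegral.integral_const_mul]
    simp [hB]
  have ibp : B = - ∫ x in (0:ℝ)..1, u x * uxx x := by
    have := intervalIntegral.integral_mul_deriv_eq_deriv_mul (a := (0:ℝ)) (b := 1)
      (fun x _ => hu x) (fun x _ => hux x)
      (cux.intervalIntegrable _ _) (huxx.intervalIntegrable _ _)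
    rw [this, hp, hpx, hB]
    simp [sq]
  have ineq2 : B ≤ lam * M0 ^ 2 + A / (4 * lam) := by
    rw [ibp, ← intervalIntegral.integral_neg]
    have : ∫ x in (0:ℝ)..1, -(u x * uxx x) ≤
        ∫ x in (0:ℝ)..1, (lam * M0 ^ 2 + (1 / (4 * lam)) * uxx x ^ 2) := by
      refine intervalIntegral.integral_mono_on zero_le_one ?_ ?_ fun x hx => ?_
      · apply Continuous.intervalIntegrable; fun_prop
      · apply Continuous.intervalIntegrable; fun_prop
      · have b1 := sq_le_sq' (abs_le.1 (h0 x hx)).1 (abs_le.1 (h0 x hx)).2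
        have b3 : lam * u x ^ 2 ≤ lam * M0 ^ 2 := mul_le_mul_of_nonneg_left b1 hlpos.le
        have b4 : lam * u x ^ 2 + (1 / (4 * lam)) * uxx x ^ 2 + u x * uxx x =
            lam * (u x + uxx x / (2 * lam)) ^ 2 := by field_simp; ring
        have b5 : 0 ≤ lam * (u x + uxx x / (2 * lam)) ^ 2 := by positivity
        linarith
    refine this.trans (le_of_eq ?_)
    rw [intervalIntegral.integral_add (by apply Continuous.intervalIntegrable; fun_prop)
      (by apply Continuous.intervalIntegrable; fun_prop), intervalIntegral.integral_const_mul]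
    simp [hA]; ring
  have hAb : A ≤ 4 * M2 ^ 2 + 4 * M1 ^ 2 * (lam * M0 ^ 2) := by
    have c1 : 2 * M1 ^ 2 * B ≤ 2 * M1 ^ 2 * (lam * M0 ^ 2 + A / (4 * lam)) :=
      mul_le_mul_of_nonneg_left ineq2 (by positivity)
    have c2 : 2 * M1 ^ 2 * (A / (4 * lam)) ≤ A / 2 := by
      rw [show 2 * M1 ^ 2 * (A / (4 * lam)) = (A / 2) * (M1 ^ 2 / lam) by field_simp; ring]
      have : M1 ^ 2 / lam ≤ 1 := by rw [div_le_one hlpos]; linarith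
      nlinarith
    nlinarith
  obtain ⟨c, hc, hc0⟩ := exists_hasDerivAt_eq_zero (zero_lt_one' ℝ) cu.continuousOn hp.symm
    (fun x _ => hu x)
  intro x hx
  have ftc : ∫ y in c..x, uxx y = ux x - ux c :=
    intervalIntegral.integral_eq_sub_of_hasDerivAt (fun y _ => hux y)
      (huxx.intervalIntegrable _ _)
  rw [hc0, sub_zero] at ftc
  rw [← ftc]
  have n1 : |∫ y in c..x, uxx y| ≤ ∫ y in Set.uIoc c x, |uxx y| := by
    simpa using intervalIntegral.norm_integral_le_integral_norm_uIoc (f := uxx) (a := c) (b := x)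
      (μ := volume)
  have n2 : ∫ y in Set.uIoc c x, |uxx y| ≤ ∫ y in Set.Ioc (0:ℝ) 1, |uxx y| := by
    refine setIntegral_mono_set ?_ ?_ ?_
    · exact (continuous_abs.comp huxx).integrableOn_Ioc
    · exact Eventually.of_forall fun y => abs_nonneg _
    · refine LE.le.eventuallyLE ?_
      exact Set.Ioc_subset_Ioc (le_min hc.1.le hx.1) (max_le hc.2.le hx.2)
  have n3 : ∫ y in Set.Ioc (0:ℝ) 1, |uxx y| ≤ 1 + A := by
    rw [← intervalIntegral.integral_of_le zero_le_one]
    have : ∫ y in (0:ℝ)..1, |uxx y| ≤ ∫ y in (0:ℝ)..1, (1 + uxx y ^ 2) := by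
      refine intervalIntegral.integral_mono_on zero_le_one ?_ ?_ fun y hy => ?_
      · apply Continuous.intervalIntegrable; fun_prop
      · apply Continuous.intervalIntegrable; fun_prop
      · nlinarith [sq_abs (uxx y), sq_nonneg (|uxx y| - 1), abs_nonneg (uxx y)]
    refine this.trans (le_of_eq ?_)
    rw [intervalIntegral.integral_add (by apply Continuous.intervalIntegrable; fun_prop)
      (by apply Continuous.intervalIntegrable; fun_prop)]
    simp [hA]
  linarith

lemma aux_coef_hilbert_sub {g₁ g₂ v₁ v₂ : ℝ → ℝ} (hg₁ : Continuous g₁) (hg₂ : Continuous g₂)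
    (hv₁ : Continuous v₁) (hv₂ : Continuous v₂)
    (h₁ : HasPeriodicHilbertTransform (fun x => (g₁ x : ℂ)) fun x => (v₁ x : ℂ))
    (h₂ : HasPeriodicHilbertTransform (fun x => (g₂ x : ℂ)) fun x => (v₂ x : ℂ)) :
    HasPeriodicHilbertTransform (fun x => ((g₁ x - g₂ x : ℝ) : ℂ))
      fun x => ((v₁ x - v₂ x : ℝ) : ℂ) := by
  intro n
  simp only [ofReal_sub]
  rw [aux_coef_sub (by fun_prop) (by fun_prop), aux_coef_sub (by fun_prop) (by fun_prop),
    h₁ n, h₂ n]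
  ring

/-- the energy inequality at a fixed time -/
lemma aux_energy {f : ℝ → ℝ} (hf : ContDiff ℝ (⊤ : ℕ∞) f) {M L B : ℝ}
    (hL : ∀ y ∈ Set.Icc (-M) M, |deriv (deriv f) y| ≤ L)
    {u₁ ux₁ uxx₁ ut₁ v₁ u₂ ux₂ uxx₂ ut₂ v₂ : ℝ → ℝ}
    (hu₁ : ∀ x, HasDerivAt u₁ (ux₁ x) x) (hux₁ : ∀ x, HasDerivAt ux₁ (uxx₁ x) x)
    (huxx₁ : Continuous uxx₁) (hv₁ : Continuous v₁) (hp₁ : u₁ 1 = u₁ 0) (hpx₁ : ux₁ 1 = ux₁ 0)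
    (hH₁ : HasPeriodicHilbertTransform (fun x => (uxx₁ x : ℂ)) fun x => (v₁ x : ℂ))
    (hM₁ : ∀ x ∈ Set.Icc (0:ℝ) 1, |u₁ x| ≤ M) (hB₁ : ∀ x ∈ Set.Icc (0:ℝ) 1, |ux₁ x| ≤ B)
    (he₁ : ∀ x, ut₁ x - v₁ x + deriv f (u₁ x) * ux₁ x = 0)
    (hu₂ : ∀ x, HasDerivAt u₂ (ux₂ x) x) (hux₂ : ∀ x, HasDerivAt ux₂ (uxx₂ x) x)
    (huxx₂ : Continuous uxx₂) (hv₂ : Continuous v₂) (hp₂ : u₂ 1 = u₂ 0) (hpx₂ : ux₂ 1 = ux₂ 0)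
    (hH₂ : HasPeriodicHilbertTransform (fun x => (uxx₂ x : ℂ)) fun x => (v₂ x : ℂ))
    (hM₂ : ∀ x ∈ Set.Icc (0:ℝ) 1, |u₂ x| ≤ M) (hB₂ : ∀ x ∈ Set.Icc (0:ℝ) 1, |ux₂ x| ≤ B)
    (he₂ : ∀ x, ut₂ x - v₂ x + deriv f (u₂ x) * ux₂ x = 0) :
    ∫ x in (0:ℝ)..1, 2 * (u₁ x - u₂ x) * (ut₁ x - ut₂ x) ≤
      (3 * L * B) * ∫ x in (0:ℝ)..1, (u₁ x - u₂ x) ^ 2 := by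
  have cux₁ : Continuous ux₁ := continuous_iff_continuousAt.2 fun x => (hux₁ x).continuousAt
  have cu₁ : Continuous u₁ := continuous_iff_continuousAt.2 fun x => (hu₁ x).continuousAt
  have cux₂ : Continuous ux₂ := continuous_iff_continuousAt.2 fun x => (hux₂ x).continuousAt
  have cu₂ : Continuous u₂ := continuous_iff_continuousAt.2 fun x => (hu₂ x).continuousAt
  have hf1 : ContDiff ℝ (⊤ : ℕ∞) (deriv f) :=
    ((contDiff_infty_iff_deriv (f := f)).1 hf).2
  have hf2 : ContDiff ℝ (⊤ : ℕ∞) (deriv (deriv f)) :=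
    ((contDiff_infty_iff_deriv (f := deriv f)).1 hf1).2
  have cf1 : Continuous (deriv f) := hf1.continuous
  have cf2 : Continuous (deriv (deriv f)) := hf2.continuous
  have df1 : ∀ y, HasDerivAt (deriv f) (deriv (deriv f) y) y := fun y =>
    ((hf1.differentiable (by simp)) y).hasDerivAt
  have skew : ∫ x in (0:ℝ)..1, (u₁ x - u₂ x) * (v₁ x - v₂ x) = 0 :=
    aux_skew (w := fun x => u₁ x - u₂ x) (wx := fun x => ux₁ x - ux₂ x)
      (wxx := fun x => uxx₁ x - uxx₂ x) (v := fun x => v₁ x - v₂ x)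
      (fun x => (hu₁ x).sub (hu₂ x)) (fun x => (hux₁ x).sub (hux₂ x))
      (huxx₁.sub huxx₂) (hv₁.sub hv₂) (by simp only [hp₁, hp₂]) (by simp only [hpx₁, hpx₂])
      (aux_coef_hilbert_sub huxx₁ huxx₂ hv₁ hv₂ hH₁ hH₂)
  -- integration by parts
  have ibp : ∫ x in (0:ℝ)..1, deriv f (u₁ x) * (2 * (u₁ x - u₂ x) * (ux₁ x - ux₂ x)) =
      - ∫ x in (0:ℝ)..1, (deriv (deriv f) (u₁ x) * ux₁ x) * (u₁ x - u₂ x) ^ 2 := by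
    have := intervalIntegral.integral_mul_deriv_eq_deriv_mul (a := (0:ℝ)) (b := 1)
      (u := fun x => deriv f (u₁ x)) (u' := fun x => deriv (deriv f) (u₁ x) * ux₁ x)
      (v := fun x => (u₁ x - u₂ x) ^ 2)
      (v' := fun x => 2 * (u₁ x - u₂ x) * (ux₁ x - ux₂ x))
      (fun x _ => (df1 (u₁ x)).comp x (hu₁ x))
      (fun x _ => by simpa using ((hu₁ x).fun_sub (hu₂ x)).fun_pow 2)
      (by apply Continuous.intervalIntegrable; fun_prop)
      (by apply Continuous.intervalIntegrable; fun_prop)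
    rw [this, hp₁, hp₂]
    simp
  have split : ∫ x in (0:ℝ)..1, 2 * (u₁ x - u₂ x) * (ut₁ x - ut₂ x) =
      ∫ x in (0:ℝ)..1, ((deriv (deriv f) (u₁ x) * ux₁ x) * (u₁ x - u₂ x) ^ 2
        - 2 * (u₁ x - u₂ x) * ((deriv f (u₁ x) - deriv f (u₂ x)) * ux₂ x)) := by
    have e : ∀ x, 2 * (u₁ x - u₂ x) * (ut₁ x - ut₂ x) =
        2 * ((u₁ x - u₂ x) * (v₁ x - v₂ x))
        - deriv f (u₁ x) * (2 * (u₁ x - u₂ x) * (ux₁ x - ux₂ x))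
        - 2 * (u₁ x - u₂ x) * ((deriv f (u₁ x) - deriv f (u₂ x)) * ux₂ x) := by
      intro x
      linear_combination (2 * (u₁ x - u₂ x)) * (he₁ x - he₂ x)
    simp only [e]
    rw [intervalIntegral.integral_sub (by apply Continuous.intervalIntegrable; fun_prop)
      (by apply Continuous.intervalIntegrable; fun_prop),
      intervalIntegral.integral_sub (by apply Continuous.intervalIntegrable; fun_prop)
      (by apply Continuous.intervalIntegrable; fun_prop),
      intervalIntegral.integral_const_mul, skew, ibp,
      intervalIntegral.integral_sub (by apply Continuous.intervalIntegrable; fun_prop)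
      (by apply Continuous.intervalIntegrable; fun_prop)]
    ring
  rw [split, ← intervalIntegral.integral_const_mul]
  refine intervalIntegral.integral_mono_on zero_le_one
    (by apply Continuous.intervalIntegrable; fun_prop)
    (by apply Continuous.intervalIntegrable; fun_prop) fun x hx => ?_
  have m1 : u₁ x ∈ Set.Icc (-M) M := abs_le.1 (hM₁ x hx)
  have m2 : u₂ x ∈ Set.Icc (-M) M := abs_le.1 (hM₂ x hx)
  have l1 : |deriv f (u₁ x) - deriv f (u₂ x)| ≤ L * |u₁ x - u₂ x| := by
    have := (convex_Icc (-M) M).norm_image_sub_le_of_norm_hasDerivWithin_le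
      (f := deriv f) (f' := deriv (deriv f)) (C := L)
      (fun y _ => (df1 y).hasDerivWithinAt) (fun y hy => by simpa using hL y hy) m2 m1
    simpa using this
  have hL0 : 0 ≤ L := (abs_nonneg _).trans (hL _ m1)
  have hB0 : 0 ≤ B := (abs_nonneg _).trans (hB₁ x hx)
  have t1 : deriv (deriv f) (u₁ x) * ux₁ x ≤ L * B := by
    refine (le_abs_self _).trans ?_
    rw [abs_mul]
    exact mul_le_mul (hL _ m1) (hB₁ x hx) (abs_nonneg _) hL0
  have t2 : -(2 * (u₁ x - u₂ x) * ((deriv f (u₁ x) - deriv f (u₂ x)) * ux₂ x)) ≤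
      2 * L * B * (u₁ x - u₂ x) ^ 2 := by
    refine (neg_le_abs _).trans ?_
    rw [abs_mul, abs_mul, abs_mul, abs_two, ← sq_abs (u₁ x - u₂ x)]
    have := mul_le_mul l1 (hB₂ x hx) (abs_nonneg _) (by positivity)
    have := mul_le_mul_of_nonneg_left this (by positivity : 0 ≤ 2 * |u₁ x - u₂ x|)
    refine this.trans (le_of_eq (by ring))
  have t3 := mul_le_mul_of_nonneg_right t1 (sq_nonneg (u₁ x - u₂ x))
  linarith

lemma aux_per_deriv {u ux : ℝ → ℝ} (hp : Function.Periodic u 1)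
    (hu : ∀ x, HasDerivAt u (ux x) x) : Function.Periodic ux 1 := by
  intro x
  have h1 := (hu (x + 1)).comp_add_const x 1
  have h2 : (fun y => u (y + 1)) = u := funext hp
  rw [h2] at h1
  exact h1.unique (hu x)

lemma aux_sol_bound {T s : ℝ} {f : ℝ → ℝ} (hf : ContDiff ℝ (⊤ : ℕ∞) f)
    {u ux uxx ut v : ℝ → ℝ → ℝ}
    (h : IsPeriodicGBOSolution' T s f u ux uxx ut v) {T' : ℝ} (hT' : T' < T) :
    ∃ M : ℝ, ∀ t ∈ Set.Icc 0 T', ∀ x ∈ Set.Icc (0:ℝ) 1,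
      |u x t| ≤ M ∧ |ux x t| ≤ M ∧ |ut x t| ≤ M := by
  have hf1 : ContDiff ℝ (⊤ : ℕ∞) (deriv f) :=
    ((contDiff_infty_iff_deriv (f := f)).1 hf).2
  have hK : IsCompact ((Set.Icc (0:ℝ) 1) ×ˢ (Set.Icc 0 T')) := isCompact_Icc.prod isCompact_Icc
  obtain ⟨M0, hM0⟩ := hK.exists_bound_of_continuousOn (f := fun p : ℝ × ℝ => u p.1 p.2)
    (h.cont.mono (Set.prod_mono (Set.subset_univ _) (Set.Icc_subset_Icc_right hT'.le)))
  obtain ⟨M2, hM2⟩ := hK.exists_bound_of_continuousOn (f := fun p : ℝ × ℝ => ut p.1 p.2)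
    (h.cont_ut.mono (Set.prod_mono (Set.subset_univ _)
      (fun t ht => ⟨ht.1, ht.2.trans_lt hT'⟩)))
  obtain ⟨M1, hM1⟩ := (isCompact_Icc (a := -M0) (b := M0)).exists_bound_of_continuousOn
    hf1.continuous.continuousOn
  set B := 1 + (4 * M2 ^ 2 + 4 * M1 ^ 2 * ((M1 ^ 2 + 1) * M0 ^ 2)) with hB
  refine ⟨max M0 (max B M2), fun t ht x hx => ?_⟩
  have ht1 : t ∈ Set.Icc 0 T := ⟨ht.1, ht.2.trans hT'.le⟩
  have ht2 : t ∈ Set.Ico 0 T := ⟨ht.1, ht.2.trans_lt hT'⟩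
  have b0 : ∀ x ∈ Set.Icc (0:ℝ) 1, |u x t| ≤ M0 := fun x hx => hM0 (x, t) ⟨hx, ht⟩
  have b2 : ∀ x ∈ Set.Icc (0:ℝ) 1, |ut x t| ≤ M2 := fun x hx => hM2 (x, t) ⟨hx, ht⟩
  have hpu := h.periodic t ht1
  have hpux : Function.Periodic (fun x => ux x t) 1 := aux_per_deriv hpu (h.deriv_x t ht1)
  have bx := aux_ux_bound (u := fun x => u x t) (ux := fun x => ux x t)
    (uxx := fun x => uxx x t) (v := fun x => v x t) (a := fun x => deriv f (u x t))
    (M0 := M0) (M1 := M1) (M2 := M2)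
    (h.deriv_x t ht1) (h.deriv_xx t ht1) (h.cont_uxx t ht1) (h.cont_v t ht2)
    (by simpa using hpu 0) (by simpa using hpux 0) (h.hilbert t ht2) b0
    (fun x hx => hM1 _ (abs_le.1 (b0 x hx)))
    (fun x hx => by
      have := h.equation x t ht2
      rw [show v x t - deriv f (u x t) * ux x t = ut x t by linarith]
      exact b2 x hx) x hx
  exact ⟨(b0 x hx).trans (le_max_left _ _),
    bx.trans ((le_max_left _ _).trans (le_max_right _ _)),
    (b2 x hx).trans ((le_max_right _ _).trans (le_max_right _ _))⟩

lemma aux_unique {T s : ℝ} {f : ℝ → ℝ} (hf : ContDiff ℝ (⊤ : ℕ∞) f)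
    {u₁ ux₁ uxx₁ ut₁ v₁ u₂ ux₂ uxx₂ ut₂ v₂ : ℝ → ℝ → ℝ}
    (h₁ : IsPeriodicGBOSolution' T s f u₁ ux₁ uxx₁ ut₁ v₁)
    (h₂ : IsPeriodicGBOSolution' T s f u₂ ux₂ uxx₂ ut₂ v₂)
    (h0 : ∀ x, u₁ x 0 = u₂ x 0) {T' : ℝ} (hT'0 : 0 ≤ T') (hT' : T' < T) (x : ℝ) :
    u₁ x T' = u₂ x T' := by
  obtain ⟨N₁, hN₁⟩ := aux_sol_bound hf h₁ hT'
  obtain ⟨N₂, hN₂⟩ := aux_sol_bound hf h₂ hT'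
  set M := max N₁ N₂ with hM
  have hM₁ : N₁ ≤ M := le_max_left _ _
  have hM₂ : N₂ ≤ M := le_max_right _ _
  have hf1 : ContDiff ℝ (⊤ : ℕ∞) (deriv f) :=
    ((contDiff_infty_iff_deriv (f := f)).1 hf).2
  have hf2 : ContDiff ℝ (⊤ : ℕ∞) (deriv (deriv f)) :=
    ((contDiff_infty_iff_deriv (f := deriv f)).1 hf1).2
  obtain ⟨L, hL⟩ := (isCompact_Icc (a := -M) (b := M)).exists_bound_of_continuousOn
    hf2.continuous.continuousOn
  have sub1 : Set.Icc 0 T' ⊆ Set.Icc 0 T := Set.Icc_subset_Icc_right hT'.le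
  have sub2 : Set.Icc 0 T' ⊆ Set.Ico 0 T := fun t ht => ⟨ht.1, ht.2.trans_lt hT'⟩
  have cx₁ : ∀ t ∈ Set.Icc 0 T', Continuous fun x => u₁ x t := fun t ht =>
    continuous_iff_continuousAt.2 fun x => (h₁.deriv_x t (sub1 ht) x).continuousAt
  have cx₂ : ∀ t ∈ Set.Icc 0 T', Continuous fun x => u₂ x t := fun t ht =>
    continuous_iff_continuousAt.2 fun x => (h₂.deriv_x t (sub1 ht) x).continuousAt
  have ctx₁ : ∀ t ∈ Set.Icc 0 T', Continuous fun x => ut₁ x t := fun t ht => by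
    rw [← continuousOn_univ]
    exact h₁.cont_ut.comp (f := fun x : ℝ => (x, t)) (by fun_prop)
      (fun x _ => ⟨Set.mem_univ _, sub2 ht⟩)
  have ctx₂ : ∀ t ∈ Set.Icc 0 T', Continuous fun x => ut₂ x t := fun t ht => by
    rw [← continuousOn_univ]
    exact h₂.cont_ut.comp (f := fun x : ℝ => (x, t)) (by fun_prop)
      (fun x _ => ⟨Set.mem_univ _, sub2 ht⟩)
  have ct₁ : ∀ x, ContinuousOn (fun t => u₁ x t) (Set.Icc 0 T') := fun x =>
    h₁.cont.comp (f := fun t : ℝ => (x, t)) (by fun_prop) (fun t ht => ⟨Set.mem_univ _, sub1 ht⟩)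
  have ct₂ : ∀ x, ContinuousOn (fun t => u₂ x t) (Set.Icc 0 T') := fun x =>
    h₂.cont.comp (f := fun t : ℝ => (x, t)) (by fun_prop) (fun t ht => ⟨Set.mem_univ _, sub1 ht⟩)
  have bw : ∀ t ∈ Set.Icc 0 T', ∀ x ∈ Set.Icc (0:ℝ) 1, |u₁ x t - u₂ x t| ≤ 2 * M := by
    intro t ht x hx
    have a1 := (hN₁ t ht x hx).1
    have a2 := (hN₂ t ht x hx).1
    have := abs_sub (u₁ x t) (u₂ x t)
    linarith
  have bwt : ∀ t ∈ Set.Icc 0 T', ∀ x ∈ Set.Icc (0:ℝ) 1, |ut₁ x t - ut₂ x t| ≤ 2 * M := by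
    intro t ht x hx
    have a1 := (hN₁ t ht x hx).2.2
    have a2 := (hN₂ t ht x hx).2.2
    have := abs_sub (ut₁ x t) (ut₂ x t)
    linarith
  have sub01 : Set.uIoc (0:ℝ) 1 ⊆ Set.Icc 0 1 := by
    rw [Set.uIoc_of_le zero_le_one]; exact Set.Ioc_subset_Icc_self
  set E : ℝ → ℝ := fun t => ∫ x in (0:ℝ)..1, (u₁ x t - u₂ x t) ^ 2 with hE
  have Econt : ContinuousOn E (Set.Icc 0 T') := by
    intro t ht
    refine intervalIntegral.continuousWithinAt_of_dominated_interval
      (F := fun t x => (u₁ x t - u₂ x t) ^ 2) (bound := fun _ => (2 * M) ^ 2) ?_ ?_ ?_ ?_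
    · filter_upwards [self_mem_nhdsWithin] with τ hτ
      have := cx₁ τ hτ
      have := cx₂ τ hτ
      exact Continuous.aestronglyMeasurable (by fun_prop)
    · filter_upwards [self_mem_nhdsWithin] with τ hτ
      refine Eventually.of_forall fun x hx => ?_
      have := bw τ hτ x (sub01 hx)
      rw [Real.norm_eq_abs, abs_pow]
      exact pow_le_pow_left₀ (abs_nonneg _) this 2
    · exact intervalIntegrable_const
    · refine Eventually.of_forall fun x hx => ?_
      exact (((ct₁ x).sub (ct₂ x)).pow 2) t ht
  have Ederiv : ∀ t ∈ Set.Ioo 0 T', HasDerivAt E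
      (∫ x in (0:ℝ)..1, 2 * (u₁ x t - u₂ x t) * (ut₁ x t - ut₂ x t)) t := by
    intro t ht
    have ht' := Set.Ioo_subset_Icc_self ht
    have := cx₁ t ht'
    have := cx₂ t ht'
    have := ctx₁ t ht'
    have := ctx₂ t ht'
    refine (intervalIntegral.hasDerivAt_integral_of_dominated_loc_of_deriv_le
      (F := fun t x => (u₁ x t - u₂ x t) ^ 2)
      (F' := fun t x => 2 * (u₁ x t - u₂ x t) * (ut₁ x t - ut₂ x t))
      (s := Set.Ioo 0 T') (bound := fun _ => 2 * (2 * M) * (2 * M)) (Ioo_mem_nhds ht.1 ht.2)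
      ?_ ?_ ?_ ?_ ?_ ?_).2
    · filter_upwards [Ioo_mem_nhds ht.1 ht.2] with τ hτ
      have := cx₁ τ (Set.Ioo_subset_Icc_self hτ)
      have := cx₂ τ (Set.Ioo_subset_Icc_self hτ)
      exact Continuous.aestronglyMeasurable (by fun_prop)
    · apply Continuous.intervalIntegrable; fun_prop
    · exact Continuous.aestronglyMeasurable (by fun_prop)
    · refine Eventually.of_forall fun x hx τ hτ => ?_
      have k1 := bw τ (Set.Ioo_subset_Icc_self hτ) x (sub01 hx)
      have k2 := bwt τ (Set.Ioo_subset_Icc_self hτ) x (sub01 hx)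
      rw [Real.norm_eq_abs, abs_mul, abs_mul, abs_two]
      have : 0 ≤ 2 * M := (abs_nonneg _).trans k1
      gcongr
    · exact intervalIntegrable_const
    · refine Eventually.of_forall fun x hx τ hτ => ?_
      have hτT : τ ∈ Set.Ico 0 T := sub2 (Set.Ioo_subset_Icc_self hτ)
      have nb : Set.Icc 0 T ∈ 𝓝 τ := Icc_mem_nhds hτ.1 hτT.2
      have d1 := (h₁.deriv_t x τ hτT).hasDerivAt nb
      have d2 := (h₂.deriv_t x τ hτT).hasDerivAt nb
      simpa using (d1.fun_sub d2).fun_pow 2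
  set K := 3 * L * M with hK
  have Eineq : ∀ t ∈ Set.Ioo 0 T',
      ∫ x in (0:ℝ)..1, 2 * (u₁ x t - u₂ x t) * (ut₁ x t - ut₂ x t) ≤ K * E t := by
    intro t ht
    have ht' := Set.Ioo_subset_Icc_self ht
    have hp1 := h₁.periodic t (sub1 ht')
    have hp2 := h₂.periodic t (sub1 ht')
    have hpx1 : Function.Periodic (fun x => ux₁ x t) 1 :=
      aux_per_deriv hp1 (h₁.deriv_x t (sub1 ht'))
    have hpx2 : Function.Periodic (fun x => ux₂ x t) 1 :=
      aux_per_deriv hp2 (h₂.deriv_x t (sub1 ht'))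
    exact aux_energy (L := L) (B := M) (M := M) hf (fun y hy => hL y hy)
      (u₁ := fun x => u₁ x t) (ux₁ := fun x => ux₁ x t) (uxx₁ := fun x => uxx₁ x t)
      (ut₁ := fun x => ut₁ x t) (v₁ := fun x => v₁ x t)
      (u₂ := fun x => u₂ x t) (ux₂ := fun x => ux₂ x t) (uxx₂ := fun x => uxx₂ x t)
      (ut₂ := fun x => ut₂ x t) (v₂ := fun x => v₂ x t)
      (h₁.deriv_x t (sub1 ht')) (h₁.deriv_xx t (sub1 ht')) (h₁.cont_uxx t (sub1 ht'))
      (h₁.cont_v t (sub2 ht')) (by simpa using hp1 0) (by simpa using hpx1 0)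
      (h₁.hilbert t (sub2 ht')) (fun x hx => (hN₁ t ht' x hx).1.trans hM₁)
      (fun x hx => (hN₁ t ht' x hx).2.1.trans hM₁) (fun x => h₁.equation x t (sub2 ht'))
      (h₂.deriv_x t (sub1 ht')) (h₂.deriv_xx t (sub1 ht')) (h₂.cont_uxx t (sub1 ht'))
      (h₂.cont_v t (sub2 ht')) (by simpa using hp2 0) (by simpa using hpx2 0)
      (h₂.hilbert t (sub2 ht')) (fun x hx => (hN₂ t ht' x hx).1.trans hM₂)
      (fun x hx => (hN₂ t ht' x hx).2.1.trans hM₂) (fun x => h₂.equation x t (sub2 ht'))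
  have Dd : ∀ t ∈ Set.Ioo 0 T', HasDerivAt (fun t => Real.exp (-K * t) * E t)
      (Real.exp (-K * t) * (-K) * E t + Real.exp (-K * t) *
        ∫ x in (0:ℝ)..1, 2 * (u₁ x t - u₂ x t) * (ut₁ x t - ut₂ x t)) t := by
    intro t ht
    have : HasDerivAt (fun t : ℝ => Real.exp (-K * t)) (Real.exp (-K * t) * (-K)) t := by
      simpa using ((hasDerivAt_id t).const_mul (-K)).exp
    exact this.mul (Ederiv t ht)
  have anti : AntitoneOn (fun t => Real.exp (-K * t) * E t) (Set.Icc 0 T') := by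
    refine antitoneOn_of_deriv_nonpos (convex_Icc _ _)
      (ContinuousOn.mul (by fun_prop) Econt) ?_ ?_
    · intro t ht
      rw [interior_Icc] at ht
      exact (Dd t ht).differentiableAt.differentiableWithinAt
    · intro t ht
      rw [interior_Icc] at ht
      rw [(Dd t ht).deriv]
      have := mul_le_mul_of_nonneg_left (Eineq t ht) (Real.exp_pos (-K * t)).le
      linarith
  have hT'm : T' ∈ Set.Icc 0 T' := ⟨hT'0, le_rfl⟩
  have E0 : E 0 = 0 := by simp [hE, h0]
  have Ele : E T' ≤ 0 := by
    have := anti ⟨le_rfl, hT'0⟩ hT'm hT'0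
    simp only [E0, mul_zero] at this
    by_contra hc
    exact absurd this (not_le.2 (mul_pos (Real.exp_pos _) (not_le.1 hc)))
  have c1 := cx₁ T' hT'm
  have c2 := cx₂ T' hT'm
  have key : ∀ y ∈ Set.Icc (0:ℝ) 1, u₁ y T' = u₂ y T' := by
    by_contra hne
    push Not at hne
    obtain ⟨y, hy, hyne⟩ := hne
    have : 0 < E T' := by
      refine intervalIntegral.integral_pos zero_lt_one (Continuous.continuousOn (by fun_prop))
        (fun _ _ => sq_nonneg _) ⟨y, hy, ?_⟩
      exact sq_pos_of_ne_zero (sub_ne_zero.2 hyne)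
    linarith
  obtain ⟨y, hy, hxy⟩ := ((h₁.periodic T' (sub1 hT'm)).sub
    (h₂.periodic T' (sub1 hT'm))).exists_mem_Ico₀ zero_lt_one x
  simp only [Pi.sub_apply] at hxy
  rw [key y (Set.Ico_subset_Icc_self hy), sub_self] at hxy
  exact sub_eq_zero.1 hxy

/-- the boundary character `e^{2πiy}` -/
def auxE (y : ℝ) : ℂ := Complex.exp (2 * Real.pi * Complex.I * y)

/-- the kernel `1/(1-e^{2πiy})` -/
def auxQ (y : ℝ) : ℂ := (1 - auxE y)⁻¹

lemma auxE_cont : Continuous auxE := by unfold auxE; fun_prop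

lemma auxQ_meas : Measurable auxQ := (measurable_const.sub auxE_cont.measurable).inv

lemma auxE_norm (y : ℝ) : ‖auxE y‖ = 1 := by
  unfold auxE
  rw [show 2 * (Real.pi : ℂ) * Complex.I * y = ((2 * Real.pi * y : ℝ) : ℂ) * Complex.I by
    push_cast; ring]
  exact Complex.norm_exp_ofReal_mul_I _

lemma auxE_lower {y : ℝ} (hy : |y| ≤ 1 / 2) : |y| ≤ ‖1 - auxE y‖ := by
  have h : ‖1 - auxE y‖ = 2 * |Real.sin (Real.pi * y)| := by
    unfold auxE
    rw [norm_sub_rev, show 2 * (Real.pi : ℂ) * Complex.I * y =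
      Complex.I * ((2 * Real.pi * y : ℝ) : ℂ) by push_cast; ring,
      Complex.norm_exp_I_mul_ofReal_sub_one, norm_mul, Real.norm_eq_abs, Real.norm_eq_abs,
      abs_two]
    congr 3; ring
  have h2 : |Real.pi * y| ≤ Real.pi / 2 := by
    rw [abs_mul, abs_of_pos Real.pi_pos]
    nlinarith [Real.pi_pos]
  have h3 := Real.mul_abs_le_abs_sin h2
  rw [abs_mul, abs_of_pos Real.pi_pos] at h3
  have h4 : 2 / Real.pi * (Real.pi * |y|) = 2 * |y| := by field_simp
  rw [h4] at h3
  rw [h]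
  linarith [abs_nonneg y]

lemma auxE_ne_one {y : ℝ} (hy : |y| ≤ 1 / 2) (h0 : y ≠ 0) : 1 - auxE y ≠ 0 := by
  intro h
  have := auxE_lower hy
  rw [h, norm_zero] at this
  exact h0 (abs_eq_zero.1 (le_antisymm this (abs_nonneg _)))

lemma aux_weighted {h : ℝ → ℂ} (hc : Continuous h)
    (hd : ∀ N : ℕ, 0 < N → ∃ C : ℝ, ∀ R : ℝ, 0 < R → R ≤ 1 →
      (∫ x in Set.Icc (-R) R, ‖h x‖ ^ 2) ≤ C * R ^ N) (k : ℕ) :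
    IntegrableOn (fun y : ℝ => ‖h y‖ ^ 2 * (|y|⁻¹) ^ k) (Set.Icc (-1) 1) := by
  obtain ⟨C, hC⟩ := hd (k + 1) (Nat.succ_pos _)
  refine ⟨(by fun_prop : Measurable _).aestronglyMeasurable, ?_⟩
  rw [hasFiniteIntegral_iff_ofReal (Eventually.of_forall fun y => by positivity)]
  set F : ℕ → ℝ → ENNReal := fun j => (Set.Icc (-(1/2:ℝ)^j) ((1/2)^j)).indicator
    (fun y => ENNReal.ofReal (2 ^ (k * (j + 1)) * ‖h y‖ ^ 2)) with hF
  have hFm : ∀ j, Measurable (F j) := fun j =>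
    Measurable.indicator (by fun_prop) measurableSet_Icc
  have step1 : ∫⁻ y in Set.Icc (-1:ℝ) 1, ENNReal.ofReal (‖h y‖ ^ 2 * (|y|⁻¹) ^ k) ≤
      ∫⁻ y, ∑' j, F j y := by
    refine (lintegral_mono_ae ?_).trans (setLIntegral_le_lintegral (Set.Icc (-1:ℝ) 1) _)
    have hne : ∀ᵐ y : ℝ, y ≠ 0 := by
      simp [ae_iff]
    filter_upwards [ae_restrict_of_ae hne, ae_restrict_mem measurableSet_Icc] with y hy0 hy
    have hyabs : |y| ≤ 1 := abs_le.2 hy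
    have hypos : 0 < |y| := abs_pos.2 hy0
    obtain ⟨j, hj1, hj2⟩ := exists_nat_pow_near_of_lt_one hypos hyabs
      (by norm_num : (0:ℝ) < 1/2) (by norm_num)
    refine le_trans ?_ (ENNReal.le_tsum j)
    rw [hF]
    simp only
    rw [Set.indicator_of_mem (show y ∈ Set.Icc (-(1/2:ℝ)^j) ((1/2)^j) from abs_le.1 hj2)]
    refine ENNReal.ofReal_le_ofReal ?_
    rw [mul_comm]
    refine mul_le_mul_of_nonneg_right ?_ (by positivity)
    rw [mul_comm k, pow_mul]
    refine pow_le_pow_left₀ (by positivity) ?_ k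
    rw [inv_le_comm₀ hypos (by positivity)]
    refine le_trans (le_of_eq ?_) hj1.le
    simp
  have step2 : ∀ j, ∫⁻ y, F j y ≤ ENNReal.ofReal (2 ^ k * C * (1/2) ^ j) := by
    intro j
    rw [hF]
    simp only
    rw [lintegral_indicator measurableSet_Icc, ← ofReal_integral_eq_lintegral_ofReal
      ((Continuous.integrableOn_Icc (by fun_prop)))
      (Eventually.of_forall fun y => by positivity)]
    refine ENNReal.ofReal_le_ofReal ?_
    rw [integral_const_mul]
    have := hC ((1/2)^j) (by positivity) (pow_le_one₀ (by norm_num) (by norm_num))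
    refine (mul_le_mul_of_nonneg_left this (by positivity)).trans (le_of_eq ?_)
    have e : (2:ℝ) ^ (k * j) * (1/2) ^ (j * k) = 1 := by
      rw [mul_comm j k, ← mul_pow]; norm_num
    rw [← pow_mul, mul_add, mul_add, pow_add, pow_add, mul_one, mul_one]
    linear_combination (2 ^ k * C * (1/2) ^ j) * e
  calc _ ≤ ∫⁻ y, ∑' j, F j y := step1
    _ = ∑' j, ∫⁻ y, F j y := lintegral_tsum fun j => (hFm j).aemeasurable
    _ ≤ ∑' j : ℕ, ENNReal.ofReal (2 ^ k * C * (1/2) ^ j) := ENNReal.tsum_le_tsum step2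
    _ < ⊤ := by
      have hC0 : 0 ≤ C := by
        have := hC 1 one_pos le_rfl
        rw [one_pow, mul_one] at this
        exact (integral_nonneg fun _ => by positivity).trans this
      have hs : Summable fun j : ℕ => 2 ^ k * C * (1/2 : ℝ) ^ j :=
        summable_geometric_two.mul_left _
      exact hs.tsum_ofReal_lt_top

lemma aux_integrable_Q {h : ℝ → ℂ} (hc : Continuous h)
    (hd : ∀ N : ℕ, 0 < N → ∃ C : ℝ, ∀ R : ℝ, 0 < R → R ≤ 1 →
      (∫ x in Set.Icc (-R) R, ‖h x‖ ^ 2) ≤ C * R ^ N) (k : ℕ) :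
    IntegrableOn (fun y : ℝ => h y * auxQ y ^ k) (Set.Ioc (-(1/2)) (1/2)) := by
  have hw := aux_weighted hc hd (2 * k)
  have hw' : IntegrableOn (fun y : ℝ => 1 + ‖h y‖ ^ 2 * (|y|⁻¹) ^ (2 * k))
      (Set.Ioc (-(1/2)) (1/2)) := by
    refine Integrable.add (integrable_const _) (hw.mono_set ?_)
    intro y hy
    exact ⟨by linarith [hy.1], by linarith [hy.2]⟩
  refine hw'.mono' (hc.measurable.mul (auxQ_meas.pow_const k)).aestronglyMeasurable ?_
  refine (ae_restrict_iff' measurableSet_Ioc).2 ?_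
  have hne : ∀ᵐ y : ℝ, y ≠ 0 := by simp [ae_iff]
  filter_upwards [hne] with y hy0 hy
  have hy' : |y| ≤ 1/2 := abs_le.2 ⟨hy.1.le, hy.2⟩
  have hypos : 0 < |y| := abs_pos.2 hy0
  have hq : ‖auxQ y‖ ≤ |y|⁻¹ := by
    unfold auxQ
    rw [norm_inv]
    exact inv_anti₀ hypos (auxE_lower hy')
  rw [norm_mul, norm_pow, mul_comm 2 k, pow_mul]
  have h1 : ‖h y‖ * ‖auxQ y‖ ^ k ≤ ‖h y‖ * (|y|⁻¹) ^ k := by gcongr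
  have h2 : 0 ≤ ‖h y‖ * (|y|⁻¹) ^ k := by positivity
  nlinarith [sq_nonneg (‖h y‖ * (|y|⁻¹) ^ k - 1)]

lemma aux_RL {ψ : ℝ → ℂ} :
    Tendsto (fun m : ℕ => ∫ y in Set.Ioc (-(1/2:ℝ)) (1/2), auxE y ^ m * ψ y) atTop (𝓝 0) := by
  have h := Real.tendsto_integral_exp_smul_cocompact
    ((Set.Ioc (-(1/2:ℝ)) (1/2)).indicator ψ)
  have hm : Tendsto (fun m : ℕ => -(m : ℝ)) atTop (cocompact ℝ) :=
    (tendsto_neg_atTop_atBot.comp tendsto_natCast_atTop_atTop).mono_right atBot_le_cocompact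
  refine (h.comp hm).congr fun m => ?_
  simp only [Function.comp]
  rw [← integral_indicator measurableSet_Ioc]
  congr 1
  funext y
  by_cases hy : y ∈ Set.Ioc (-(1/2:ℝ)) (1/2)
  · rw [Set.indicator_of_mem hy, Set.indicator_of_mem hy, Circle.smul_def, smul_eq_mul,
      Real.fourierChar_apply]
    unfold auxE
    rw [← Complex.exp_nat_mul]
    congr 2
    push_cast
    ring
  · rw [Set.indicator_of_notMem hy, Set.indicator_of_notMem hy, smul_zero]

lemma aux_moments {h : ℝ → ℂ} (hc : Continuous h) (hp : Function.Periodic h 1)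
    (hd : ∀ N : ℕ, 0 < N → ∃ C : ℝ, ∀ R : ℝ, 0 < R → R ≤ 1 →
      (∫ x in Set.Icc (-R) R, ‖h x‖ ^ 2) ≤ C * R ^ N)
    (hF : ∀ m : ℕ, fourierCoefP h (-(m : ℤ)) = 0) (k : ℕ) : ∀ m : ℕ,
    ∫ y in Set.Ioc (-(1/2:ℝ)) (1/2), auxE y ^ m * (h y * auxQ y ^ k) = 0 := by
  have hInt0 : ∀ k m : ℕ, IntegrableOn (fun y => auxE y ^ m * (h y * auxQ y ^ k))
      (Set.Ioc (-(1/2:ℝ)) (1/2)) := by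
    intro k m
    refine (aux_integrable_Q hc hd k).bdd_mul (c := 1)
      (auxE_cont.pow m).aestronglyMeasurable ?_
    exact Eventually.of_forall fun y => by simp [auxE_norm]
  induction k with
  | zero =>
    intro m
    have hper : Function.Periodic (fun y => auxE y ^ m * h y) 1 := by
      intro y
      have : auxE (y + 1) = auxE y := by
        unfold auxE
        push_cast
        rw [show 2 * (Real.pi : ℂ) * Complex.I * (y + 1) =
          2 * Real.pi * Complex.I * y + 2 * Real.pi * Complex.I by ring, Complex.exp_add,
          Complex.exp_two_pi_mul_I, mul_one]
      simp only [this, hp y]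
    have h1 := hF m
    unfold fourierCoefP at h1
    have h2 := hper.intervalIntegral_add_eq 0 (-(1/2))
    rw [zero_add, show -(1/2:ℝ) + 1 = 1/2 by norm_num] at h2
    simp only [pow_zero, mul_one]
    rw [← intervalIntegral.integral_of_le (by norm_num), ← h2, ← h1]
    congr 1
    funext x
    unfold auxE
    rw [← Complex.exp_nat_mul]
    congr 2
    push_cast
    ring
  | succ k ih =>
    have hrec : ∀ m : ℕ, ∫ y in Set.Ioc (-(1/2:ℝ)) (1/2), auxE y ^ m * (h y * auxQ y ^ (k+1)) =
        ∫ y in Set.Ioc (-(1/2:ℝ)) (1/2), auxE y ^ (m+1) * (h y * auxQ y ^ (k+1)) := by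
      intro m
      rw [← sub_eq_zero, ← integral_sub (hInt0 _ _) (hInt0 _ _), ← ih m]
      refine setIntegral_congr_ae measurableSet_Ioc ?_
      have hne : ∀ᵐ y : ℝ, y ≠ 0 := by simp [ae_iff]
      filter_upwards [hne] with y hy0 hy
      have := auxE_ne_one (abs_le.2 ⟨hy.1.le, hy.2⟩) hy0
      have hq : (1 - auxE y) * auxQ y = 1 := mul_inv_cancel₀ this
      rw [pow_succ (auxQ y)]
      linear_combination (auxE y ^ m * h y * auxQ y ^ k) * hq
    intro m
    have hconst : ∀ p : ℕ,
        ∫ y in Set.Ioc (-(1/2:ℝ)) (1/2), auxE y ^ m * (h y * auxQ y ^ (k+1)) =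
        ∫ y in Set.Ioc (-(1/2:ℝ)) (1/2), auxE y ^ (p + m) * (h y * auxQ y ^ (k+1)) := by
      intro p
      induction p with
      | zero => rw [zero_add]
      | succ p ihp => rw [ihp, hrec, show p + m + 1 = p + 1 + m by ring]
    have lim := (tendsto_add_atTop_iff_nat m).2
      (aux_RL (ψ := fun y => h y * auxQ y ^ (k+1)))
    have lim2 := lim.congr (fun p => (hconst p).symm)
    exact tendsto_nhds_unique tendsto_const_nhds lim2

/-- `cot (π y)` -/
def auxCot (y : ℝ) : ℝ := Real.cos (Real.pi * y) / Real.sin (Real.pi * y)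

lemma auxCot_eq {y : ℝ} (hs : Real.sin (Real.pi * y) ≠ 0) :
    (auxCot y : ℂ) = Complex.I - 2 * Complex.I * auxQ y := by
  have he : auxE y = (Complex.cos (Real.pi * y) + Complex.sin (Real.pi * y) * Complex.I) ^ 2 := by
    unfold auxE
    rw [← Complex.exp_mul_I, ← Complex.exp_nat_mul]
    congr 1
    push_cast
    ring
  have hcs := Complex.sin_sq_add_cos_sq (Real.pi * y)
  have hsC : Complex.sin (Real.pi * y) ≠ 0 := by
    rw [← Complex.ofReal_mul, ← Complex.ofReal_sin]
    exact_mod_cast hs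
  unfold auxCot auxQ
  push_cast
  set c := Complex.cos (Real.pi * y)
  set s := Complex.sin (Real.pi * y)
  have hI := Complex.I_sq
  have h1 : 1 - auxE y = 2 * s * (s - c * Complex.I) := by
    rw [he]; linear_combination -hcs - s^2 * hI
  have h2 : (s - c * Complex.I) * (s + c * Complex.I) = 1 := by
    linear_combination hcs - c^2 * hI
  have h3 : s - c * Complex.I ≠ 0 := left_ne_zero_of_mul_eq_one h2
  rw [h1]
  field_simp
  linear_combination (-Complex.I) * hcs + (c * s) * hI

lemma aux_poly {h : ℝ → ℂ} (hc : Continuous h) (hp : Function.Periodic h 1)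
    (hd : ∀ N : ℕ, 0 < N → ∃ C : ℝ, ∀ R : ℝ, 0 < R → R ≤ 1 →
      (∫ x in Set.Icc (-R) R, ‖h x‖ ^ 2) ≤ C * R ^ N)
    (hF : ∀ m : ℕ, fourierCoefP h (-(m : ℤ)) = 0) (P : Polynomial ℂ) :
    IntegrableOn (fun y => h y * P.eval (auxQ y)) (Set.Ioc (-(1/2:ℝ)) (1/2)) ∧
    ∫ y in Set.Ioc (-(1/2:ℝ)) (1/2), h y * P.eval (auxQ y) = 0 := by
  induction P using Polynomial.induction_on' with
  | add p q hp hq =>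
    simp only [Polynomial.eval_add, mul_add]
    exact ⟨hp.1.add hq.1, by rw [integral_add hp.1 hq.1, hp.2, hq.2, add_zero]⟩
  | monomial n a =>
    have e : (fun y => h y * (Polynomial.monomial n a).eval (auxQ y)) =
        fun y => a * (h y * auxQ y ^ n) := by
      funext y
      rw [Polynomial.eval_monomial]
      ring
    rw [e]
    refine ⟨(aux_integrable_Q hc hd n).const_mul a, ?_⟩
    rw [integral_const_mul]
    have := aux_moments hc hp hd hF n 0
    simp only [pow_zero, one_mul] at this
    rw [this, mul_zero]

lemma aux_real_poly {g v : ℝ → ℝ} (hg : Continuous g) (hv : Continuous v)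
    (hpg : Function.Periodic g 1) (hpv : Function.Periodic v 1)
    (hd : ∀ N : ℕ, 0 < N → ∃ C : ℝ, ∀ R : ℝ, 0 < R → R ≤ 1 →
      (∫ x in Set.Icc (-R) R, ‖(g x : ℂ) + v x * Complex.I‖ ^ 2) ≤ C * R ^ N)
    (hF : ∀ m : ℕ, fourierCoefP (fun x => (g x : ℂ) + v x * Complex.I) (-(m : ℤ)) = 0)
    (p : Polynomial ℝ) :
    ∫ y in (0:ℝ)..1, g y * p.eval (auxCot y) = 0 := by
  set P : Polynomial ℂ := (p.map Complex.ofRealHom).comp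
    (Polynomial.C Complex.I - Polynomial.C (2 * Complex.I) * Polynomial.X) with hP
  obtain ⟨i1, i2⟩ := aux_poly (h := fun x => (g x : ℂ) + v x * Complex.I) (by fun_prop)
    (fun x => by simp only [hpg x, hpv x]) hd hF P
  have hre := congrArg Complex.re i2
  rw [← RCLike.re_eq_complex_re, ← integral_re i1] at hre
  have hper : Function.Periodic (fun y => g y * p.eval (auxCot y)) 1 := by
    intro y
    have : auxCot (y + 1) = auxCot y := by
      unfold auxCot
      rw [mul_add, mul_one, Real.cos_add_pi, Real.sin_add_pi, neg_div_neg_eq]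
    simp only [this, hpg y]
  have h2 := hper.intervalIntegral_add_eq 0 (-(1/2))
  rw [zero_add, show -(1/2:ℝ) + 1 = 1/2 by norm_num] at h2
  rw [h2, intervalIntegral.integral_of_le (by norm_num)]
  simp only [RCLike.re_eq_complex_re, Complex.zero_re] at hre
  rw [← hre]
  refine setIntegral_congr_ae measurableSet_Ioc ?_
  have hne : ∀ᵐ y : ℝ, y ≠ 0 := by simp [ae_iff]
  filter_upwards [hne] with y hy0 hy
  have hs : Real.sin (Real.pi * y) ≠ 0 := by
    intro h0
    have h2 : |Real.pi * y| ≤ Real.pi / 2 := by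
      rw [abs_mul, abs_of_pos Real.pi_pos]
      nlinarith [Real.pi_pos, abs_le.2 ⟨hy.1.le, hy.2⟩]
    have h3 := Real.mul_abs_le_abs_sin h2
    rw [h0, abs_zero] at h3
    have : 0 < 2 / Real.pi * |Real.pi * y| := by
      have := abs_pos.2 (mul_ne_zero Real.pi_ne_zero hy0)
      positivity
    linarith
  have ev : P.eval (auxQ y) = ((p.eval (auxCot y) : ℝ) : ℂ) := by
    rw [hP, Polynomial.eval_comp]
    simp only [Polynomial.eval_sub, Polynomial.eval_mul, Polynomial.eval_C, Polynomial.eval_X]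
    rw [← auxCot_eq hs, Polynomial.eval_map, ← Complex.ofRealHom_eq_coe,
      Polynomial.eval₂_at_apply]
    rfl
  rw [ev]
  simp

lemma aux_g_zero {g : ℝ → ℝ} (hg : Continuous g) {δ : ℝ} (hδ0 : 0 < δ) (hδ1 : δ < 1 / 2)
    (hpg : Function.Periodic g 1)
    (hz : ∀ y, |y| ≤ δ → g y = 0)
    (hm : ∀ p : Polynomial ℝ, ∫ y in (0:ℝ)..1, g y * p.eval (auxCot y) = 0) :
    ∀ y, g y = 0 := by
  set K : Set ℝ := Set.Icc δ (1 - δ) with hK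
  have hz2 : ∀ y ∈ Set.Icc (0:ℝ) 1, y ∉ K → g y = 0 := by
    intro y hy hyK
    by_cases h : y < δ
    · exact hz y (abs_le.2 ⟨by linarith [hy.1], h.le⟩)
    · have h' : 1 - δ < y := by
        by_contra hc
        exact hyK ⟨not_lt.1 h, not_lt.1 hc⟩
      have := hpg (y - 1)
      rw [sub_add_cancel] at this
      rw [this]
      exact hz _ (abs_le.2 ⟨by linarith, by linarith [hy.2]⟩)
  have hsin : ∀ y ∈ K, 0 < Real.sin (Real.pi * y) := by
    intro y hy
    refine Real.sin_pos_of_pos_of_lt_pi (mul_pos Real.pi_pos (by linarith [hy.1])) ?_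
    nlinarith [Real.pi_pos, hy.2]
  have hcc : ContinuousOn auxCot K := by
    unfold auxCot
    exact ContinuousOn.div (by fun_prop) (by fun_prop) fun y hy => (hsin y hy).ne'
  let cotK : C(K, ℝ) := ⟨K.domRestrict auxCot, hcc.domRestrict⟩
  have hsep : (Algebra.adjoin ℝ {cotK}).SeparatesPoints := by
    intro a b hab
    refine ⟨cotK, ⟨cotK, Algebra.subset_adjoin (Set.mem_singleton _), rfl⟩, ?_⟩
    intro heq
    apply hab
    have h1 : auxCot a = auxCot b := heq
    unfold auxCot at h1
    rw [div_eq_div_iff (hsin a a.2).ne' (hsin b b.2).ne'] at h1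
    have h2 : Real.sin (Real.pi * b - Real.pi * a) = 0 := by
      rw [Real.sin_sub]; linarith
    have ha := a.2
    have hb := b.2
    have h3 := (Real.sin_eq_zero_iff_of_lt_of_lt (by nlinarith [Real.pi_pos, ha.2, hb.1])
      (by nlinarith [Real.pi_pos, ha.1, hb.2])).1 h2
    apply Subtype.ext
    have : Real.pi * (b - a) = 0 := by linarith
    rcases mul_eq_zero.1 this with h | h
    · exact absurd h Real.pi_ne_zero
    · linarith
  have : CompactSpace K := isCompact_iff_compactSpace.1 isCompact_Icc
  have happ : ∀ ε > 0, ∃ p : Polynomial ℝ, ∀ y ∈ K, |p.eval (auxCot y) - g y| < ε := by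
    intro ε hε
    obtain ⟨⟨q, hq⟩, hq2⟩ := ContinuousMap.exists_mem_subalgebra_near_continuous_of_separatesPoints
      _ hsep (K.domRestrict g) hg.continuousOn.domRestrict ε hε
    rw [Algebra.adjoin_singleton_eq_range_aeval] at hq
    obtain ⟨p, rfl⟩ := hq
    refine ⟨p, fun y hy => ?_⟩
    have := hq2 ⟨y, hy⟩
    simp only [Real.norm_eq_abs] at this
    have e : (Polynomial.aeval cotK p : C(K, ℝ)) ⟨y, hy⟩ = p.eval (auxCot y) := by
      rw [Polynomial.aeval_continuousMap_apply]
      rfl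
    rw [← e]
    exact this
  have hI : ∀ ε > 0, ∫ y in (0:ℝ)..1, g y ^ 2 ≤ ε * ∫ y in (0:ℝ)..1, |g y| := by
    intro ε hε
    obtain ⟨p, hp⟩ := happ ε hε
    have ptw : ∀ y ∈ Set.Icc (0:ℝ) 1, |g y * p.eval (auxCot y) - g y ^ 2| ≤ ε * |g y| := by
      intro y hy
      by_cases hyK : y ∈ K
      · rw [show g y * p.eval (auxCot y) - g y ^ 2 = (p.eval (auxCot y) - g y) * g y by ring,
          abs_mul]
        exact mul_le_mul_of_nonneg_right (hp y hyK).le (abs_nonneg _)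
      · simp [hz2 y hy hyK]
    have hmeas : Measurable (fun y => g y * p.eval (auxCot y)) := by
      refine hg.measurable.mul (p.continuous.measurable.comp ?_)
      unfold auxCot
      fun_prop
    have ii1 : IntervalIntegrable (fun y => ε * |g y|) volume 0 1 := by
      apply Continuous.intervalIntegrable; fun_prop
    have ii2 : IntervalIntegrable (fun y => g y ^ 2) volume 0 1 := by
      apply Continuous.intervalIntegrable; fun_prop
    have ii3 : IntervalIntegrable (fun y => g y * p.eval (auxCot y)) volume 0 1 := by
      refine (ii1.add ii2).mono_fun' hmeas.aestronglyMeasurable ?_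
      refine (ae_restrict_iff' measurableSet_uIoc).2 (Eventually.of_forall fun y hy => ?_)
      rw [Set.uIoc_of_le zero_le_one] at hy
      have := ptw y (Set.Ioc_subset_Icc_self hy)
      simp only [Real.norm_eq_abs]
      rw [abs_le] at this ⊢
      constructor <;> nlinarith [sq_nonneg (g y)]
    have : ∫ y in (0:ℝ)..1, g y ^ 2 =
        ∫ y in (0:ℝ)..1, (g y ^ 2 - g y * p.eval (auxCot y)) := by
      rw [intervalIntegral.integral_sub ii2 ii3, hm p, sub_zero]
    rw [this, ← intervalIntegral.integral_const_mul]
    refine intervalIntegral.integral_mono_on zero_le_one (ii2.sub ii3) ii1 fun y hy => ?_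
    have := (abs_le.1 (ptw y hy)).1
    linarith
  have hA0 : 0 ≤ ∫ y in (0:ℝ)..1, |g y| :=
    intervalIntegral.integral_nonneg zero_le_one fun y _ => abs_nonneg _
  have hle : ∫ y in (0:ℝ)..1, g y ^ 2 ≤ 0 := by
    refine le_of_forall_pos_le_add fun ε hε => ?_
    set A := ∫ y in (0:ℝ)..1, |g y|
    refine (hI (ε / (A + 1)) (by positivity)).trans ?_
    rw [zero_add, div_mul_eq_mul_div, div_le_iff₀ (by positivity)]
    nlinarith
  have key : ∀ y ∈ Set.Icc (0:ℝ) 1, g y = 0 := by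
    by_contra hne
    push Not at hne
    obtain ⟨y, hy, hyne⟩ := hne
    have : 0 < ∫ y in (0:ℝ)..1, g y ^ 2 :=
      intervalIntegral.integral_pos zero_lt_one (Continuous.continuousOn (by fun_prop))
        (fun _ _ => sq_nonneg _) ⟨y, hy, sq_pos_of_ne_zero hyne⟩
    linarith
  intro x
  obtain ⟨y, hy, hxy⟩ := hpg.exists_mem_Ico₀ zero_lt_one x
  rw [hxy, key y (Set.Ico_subset_Icc_self hy)]

lemma aux_slice {g v k : ℝ → ℝ} {G : ℝ → ℝ} (hG : ∀ x, HasDerivAt G (g x) x)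
    (hG1 : G 1 = G 0) (hg : Continuous g) (hv : Continuous v)
    (hpg : Function.Periodic g 1) (hpv : Function.Periodic v 1)
    (hH : HasPeriodicHilbertTransform (fun x => (g x : ℂ)) fun x => (v x : ℂ))
    {δ : ℝ} (hδ0 : 0 < δ) (hδ1 : δ < 1 / 2) (hz : ∀ y, |y| ≤ δ → g y = 0)
    (hk : ∀ y, |y| ≤ δ → v y = k y)
    (hdecay : ∀ N : ℕ, 0 < N → ∃ c > (0 : ℝ), ∃ R₀ > (0 : ℝ), ∀ R : ℝ, 0 < R → R ≤ R₀ →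
      (∫ x in Set.Icc (-R) R, |k x| ^ 2) ≤ c * R ^ N) :
    ∀ y, g y = 0 := by
  refine aux_g_zero hg hδ0 hδ1 hpg hz fun p => aux_real_poly hg hv hpg hpv ?_ ?_ p
  · intro N hN
    obtain ⟨c, hc, R₀, hR₀, h⟩ := hdecay N hN
    set r := min δ R₀ with hr
    have hr0 : 0 < r := lt_min hδ0 hR₀
    set S := ∫ x in Set.Icc (-1:ℝ) 1, ‖(g x : ℂ) + v x * Complex.I‖ ^ 2 with hS
    have hS0 : 0 ≤ S := integral_nonneg fun _ => by positivity
    refine ⟨c + S / r ^ N, fun R hR hR1 => ?_⟩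
    by_cases hRr : R ≤ r
    · have e : ∫ x in Set.Icc (-R) R, ‖(g x : ℂ) + v x * Complex.I‖ ^ 2 =
          ∫ x in Set.Icc (-R) R, |k x| ^ 2 := by
        refine setIntegral_congr_fun measurableSet_Icc fun x hx => ?_
        have hx' : |x| ≤ δ := (abs_le.2 hx).trans (hRr.trans (min_le_left _ _))
        simp [hz x hx', hk x hx']
      rw [e]
      refine (h R hR (hRr.trans (min_le_right _ _))).trans ?_
      have : 0 ≤ S / r ^ N * R ^ N := by positivity
      linarith
    · have hrR := (not_le.1 hRr).le
      have m : ∫ x in Set.Icc (-R) R, ‖(g x : ℂ) + v x * Complex.I‖ ^ 2 ≤ S := by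
        refine setIntegral_mono_set ?_ ?_ ?_
        · exact Continuous.integrableOn_Icc (by fun_prop)
        · exact Eventually.of_forall fun y => by positivity
        · refine LE.le.eventuallyLE ?_
          exact Set.Icc_subset_Icc (by linarith) hR1
      refine m.trans ?_
      have : S ≤ S / r ^ N * R ^ N := by
        rw [div_mul_eq_mul_div, le_div_iff₀ (by positivity)]
        exact mul_le_mul_of_nonneg_left (pow_le_pow_left₀ hr0.le hrR N) hS0
      have : 0 ≤ c * R ^ N := by positivity
      linarith
  · intro m
    rw [aux_coef_add (f := fun x => (g x : ℂ)) (g := fun x => (v x : ℂ) * Complex.I)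
      (by fun_prop) (by fun_prop)]
    have e : fourierCoefP (fun x => (v x : ℂ) * Complex.I) (-(m:ℤ)) =
        fourierCoefP (fun x => (v x : ℂ)) (-(m:ℤ)) * Complex.I := by
      unfold fourierCoefP
      rw [← intervalIntegral.integral_mul_const]
      simp only [mul_assoc]
    rw [e, hH]
    rcases Nat.eq_zero_or_pos m with hm | hm
    · subst hm
      have := aux_coef_zero hG hg hG1
      simp [this]
    · rw [Int.sign_eq_neg_one_of_neg (by omega)]
      push_cast
      linear_combination (fourierCoefP (fun x => (g x : ℂ)) (-(m:ℤ))) * Complex.I_sq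

lemma aux_deriv_zero_of_local {w wx : ℝ → ℝ} {J : Set ℝ} (hJ : IsOpen J)
    (hw : ∀ x, HasDerivAt w (wx x) x) (h : ∀ x ∈ J, w x = 0) : ∀ x ∈ J, wx x = 0 := by
  intro x hx
  have h1 : w =ᶠ[𝓝 x] fun _ => (0:ℝ) := by
    filter_upwards [hJ.mem_nhds hx] with y hy using h y hy
  exact (hw x).unique ((hasDerivAt_const x (0:ℝ)).congr_of_eventuallyEq h1)

lemma aux_zero_of_deriv_zero {w wx : ℝ → ℝ} (hw : ∀ x, HasDerivAt w (wx x) x)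
    (h : ∀ x, wx x = 0) (h0 : w 0 = 0) : ∀ x, w x = 0 := by
  intro x
  rw [← h0]
  exact is_const_of_deriv_eq_zero (fun y => (hw y).differentiableAt)
    (fun y => by rw [(hw y).deriv, h y]) x 0

/-- **Unique continuation for the generalized Benjamin–Ono equation on the circle from
time-slice data.** Let `f : ℝ → ℝ` be smooth with `f(0) = 0` and let
`u₁, u₂ ∈ C([0,T] : H^s(𝕊¹))`, `s > 5/2`, be solutions of `∂ₜu - ℋ∂ₓ²u + ∂ₓ(f(u)) = 0`
(realized as `1`-periodic functions in `x`) which coincide at `t = 0` on an open set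
`I ⊆ [-1/2, 1/2]` with `0 ∈ I`, and such that
`∫_{|x| ≤ R} |∂ₜu₁(x,0) - ∂ₜu₂(x,0)|² dx ≤ c_N R^N` as `R ↓ 0` for every positive integer
`N`. Then `u₁ = u₂` on `𝕊¹ × [0,T]`. -/
theorem periodic_generalized_benjamin_ono_unique_continuation_from_slice
    (T s : ℝ) (hT : 0 < T) (hs : 5 / 2 < s)
    (f : ℝ → ℝ) (hf : ContDiff ℝ (⊤ : ℕ∞) f) (hf0 : f 0 = 0)
    (u₁ ux₁ uxx₁ ut₁ v₁ u₂ ux₂ uxx₂ ut₂ v₂ : ℝ → ℝ → ℝ)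
    (h₁ : IsPeriodicGBOSolution' T s f u₁ ux₁ uxx₁ ut₁ v₁)
    (h₂ : IsPeriodicGBOSolution' T s f u₂ ux₂ uxx₂ ut₂ v₂)
    (I : Set ℝ) (hI_open : IsOpen I) (hI_sub : I ⊆ Set.Icc (-(1 / 2)) (1 / 2)) (hI0 : (0 : ℝ) ∈ I)
    (h_agree : ∀ x ∈ I, u₁ x 0 = u₂ x 0)
    (hdecay : ∀ N : ℕ, 0 < N → ∃ c > (0 : ℝ), ∃ R₀ > (0 : ℝ), ∀ R : ℝ, 0 < R → R ≤ R₀ →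
      (∫ x in Set.Icc (-R) R, |ut₁ x 0 - ut₂ x 0| ^ 2) ≤ c * R ^ N) :
    ∀ x : ℝ, ∀ t ∈ Set.Icc 0 T, u₁ x t = u₂ x t := by
  have m0 : (0:ℝ) ∈ Set.Icc 0 T := ⟨le_rfl, hT.le⟩
  have m0' : (0:ℝ) ∈ Set.Ico 0 T := ⟨le_rfl, hT⟩
  have hw : ∀ x, HasDerivAt (fun x => u₁ x 0 - u₂ x 0) (ux₁ x 0 - ux₂ x 0) x := fun x =>
    (h₁.deriv_x 0 m0 x).sub (h₂.deriv_x 0 m0 x)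
  have hwx : ∀ x, HasDerivAt (fun x => ux₁ x 0 - ux₂ x 0) (uxx₁ x 0 - uxx₂ x 0) x := fun x =>
    (h₁.deriv_xx 0 m0 x).sub (h₂.deriv_xx 0 m0 x)
  have hwI : ∀ x ∈ I, u₁ x 0 - u₂ x 0 = 0 := fun x hx => sub_eq_zero.2 (h_agree x hx)
  have hwxI : ∀ x ∈ I, ux₁ x 0 - ux₂ x 0 = 0 := aux_deriv_zero_of_local hI_open hw hwI
  have hwxxI : ∀ x ∈ I, uxx₁ x 0 - uxx₂ x 0 = 0 := aux_deriv_zero_of_local hI_open hwx hwxI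
  obtain ⟨ε, hε, hball⟩ := Metric.isOpen_iff.1 hI_open 0 hI0
  obtain ⟨δ, hδ0, hδ⟩ := exists_between (lt_min hε (by norm_num : (0:ℝ) < 1 / 2))
  have hδI : ∀ y, |y| ≤ δ → y ∈ I := fun y hy => hball (by
    rw [Metric.mem_ball, dist_zero_right, Real.norm_eq_abs]
    exact hy.trans_lt (hδ.trans_le (min_le_left _ _)))
  have pu₁ := h₁.periodic 0 m0
  have pu₂ := h₂.periodic 0 m0
  have pux₁ : Function.Periodic (fun x => ux₁ x 0) 1 := aux_per_deriv pu₁ (h₁.deriv_x 0 m0)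
  have pux₂ : Function.Periodic (fun x => ux₂ x 0) 1 := aux_per_deriv pu₂ (h₂.deriv_x 0 m0)
  have puxx₁ : Function.Periodic (fun x => uxx₁ x 0) 1 := aux_per_deriv pux₁ (h₁.deriv_xx 0 m0)
  have puxx₂ : Function.Periodic (fun x => uxx₂ x 0) 1 := aux_per_deriv pux₂ (h₂.deriv_xx 0 m0)
  have hg0 : ∀ x, uxx₁ x 0 - uxx₂ x 0 = 0 := by
    refine aux_slice (g := fun x => uxx₁ x 0 - uxx₂ x 0) (v := fun x => v₁ x 0 - v₂ x 0)
      (k := fun x => ut₁ x 0 - ut₂ x 0) (G := fun x => ux₁ x 0 - ux₂ x 0) hwx ?_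
      ((h₁.cont_uxx 0 m0).sub (h₂.cont_uxx 0 m0)) ((h₁.cont_v 0 m0').sub (h₂.cont_v 0 m0'))
      (puxx₁.sub puxx₂) ((h₁.periodic_v 0 m0').sub (h₂.periodic_v 0 m0'))
      (aux_coef_hilbert_sub (h₁.cont_uxx 0 m0) (h₂.cont_uxx 0 m0) (h₁.cont_v 0 m0')
        (h₂.cont_v 0 m0') (h₁.hilbert 0 m0') (h₂.hilbert 0 m0'))
      hδ0 (hδ.trans_le (min_le_right _ _)) (fun y hy => hwxxI y (hδI y hy)) ?_ hdecay
    · have a1 := pux₁ 0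
      have a2 := pux₂ 0
      simp only [zero_add] at a1 a2
      simp only [a1, a2]
    · intro y hy
      have hyI := hδI y hy
      have e1 := h₁.equation y 0 m0'
      have e2 := h₂.equation y 0 m0'
      rw [h_agree y hyI, sub_eq_zero.1 (hwxI y hyI)] at e1
      linarith
  have hwx0 := aux_zero_of_deriv_zero hwx hg0 (hwxI 0 hI0)
  have hw0 := aux_zero_of_deriv_zero hw hwx0 (hwI 0 hI0)
  have h0 : ∀ x, u₁ x 0 = u₂ x 0 := fun x => sub_eq_zero.1 (hw0 x)
  intro x t ht
  rcases ht.2.lt_or_eq with hlt | rfl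
  · exact aux_unique hf h₁ h₂ h0 ht.1 hlt x
  · -- the final time, by continuity
    have c₁ : ContinuousOn (fun τ => u₁ x τ) (Set.Icc 0 t) :=
      h₁.cont.comp (f := fun τ : ℝ => (x, τ)) (by fun_prop) (fun τ hτ => ⟨Set.mem_univ _, hτ⟩)
    have c₂ : ContinuousOn (fun τ => u₂ x τ) (Set.Icc 0 t) :=
      h₂.cont.comp (f := fun τ : ℝ => (x, τ)) (by fun_prop) (fun τ hτ => ⟨Set.mem_univ _, hτ⟩)
    have heq : Set.EqOn (fun τ => u₁ x τ) (fun τ => u₂ x τ) (Set.Ico 0 t) := fun τ hτ =>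
      aux_unique hf h₁ h₂ h0 hτ.1 hτ.2 x
    exact heq.of_subset_closure c₁ c₂ Set.Ico_subset_Icc_self
      (by rw [closure_Ico hT.ne]) ht
end
end
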